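/- arXiv:1805.06978 — 9 statements merged into one kernel-verified Lean document; each statement's English description precedes it below -/
import Mathlib

section
/- Let L1 and L2 be properly Lorentz-Minkowski norms on V with the same cone domain A (hence with the same boundary cone C = Ā ∖ A). Then there exists a positively 0-homogeneous function μ : Ā → (0,∞) which is smooth on Ā (in the within-set sense) such that L2(v) = μ(v)·L1(v) for every v ∈ Ā. Moreover, for every v ∈ C there exists w ∈ V with g¹_v(v,w) ≠ 0, and for every such w one also has g²_v(v,w) ≠ 0 and μ(v) = g²_v(v,w)/g¹_v(v,w), where g¹ and g² denote the fundamental tensors of L1 and L2 respectively (in particular the ratio g²_v(v,w)/g¹_v(v,w) is independent of the choice of w). -/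
open Set Module

noncomputable section

variable {V : Type*} [NormedAddCommGroup V] [NormedSpace ℝ V]

/-- A subset of `V` is conic if stable under multiplication by positive scalars. -/
def Conic (s : Set V) : Prop := ∀ v ∈ s, ∀ c : ℝ, 0 < c → c • v ∈ s

/-- Positively 2-homogeneous on a set. -/
def PosHom2 (L : V → ℝ) (s : Set V) : Prop :=
  ∀ v ∈ s, ∀ c : ℝ, 0 < c → L (c • v) = c ^ 2 * L v

/-- Positively 0-homogeneous on a set. -/
def PosHom0 (f : V → ℝ) (s : Set V) : Prop :=
  ∀ v ∈ s, ∀ c : ℝ, 0 < c → f (c • v) = f v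

/-- The fundamental tensor of `L` at `v`: `g_v(u,w) = (1/2) D²L(v)(u,w)`. -/
def fundTensor (L : V → ℝ) (v u w : V) : ℝ :=
  (1 / 2 : ℝ) * fderiv ℝ (fderiv ℝ L) v u w

/-- A bilinear-type form on `V` is Lorentzian (nondegenerate with index `n-1`) if it is
nondegenerate and negative definite on some subspace of dimension `n-1`. -/
def IsLorentzForm (g : V → V → ℝ) : Prop :=
  (∀ u : V, (∀ w : V, g u w = 0) → u = 0) ∧
  ∃ W : Submodule ℝ V, finrank ℝ W = finrank ℝ V - 1 ∧
    ∀ u ∈ W, u ≠ 0 → g u u < 0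

/-- A properly Lorentz-Minkowski norm on `V` with cone domain `A`. -/
structure IsProperLMNorm (L : V → ℝ) (A : Set V) : Prop where
  nonempty : A.Nonempty
  zero_not_mem : (0 : V) ∉ A
  isOpen : IsOpen A
  isConnected : IsConnected A
  conic : Conic A
  pos : ∀ v ∈ A, 0 < L v
  zero_on_bd : ∀ v ∈ (closure A \ {0}) \ A, L v = 0
  smooth_ext : ∃ Astar : Set V, IsOpen Astar ∧ Conic Astar ∧ (0 : V) ∉ Astar ∧
    closure A \ {0} ⊆ Astar ∧ ContDiffOn ℝ (⊤ : ℕ∞) L Astar ∧ PosHom2 L Astar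
  lorentz : ∀ v ∈ closure A \ {0}, IsLorentzForm (fundTensor L v)

open scoped ContDiff Topology

/-- Differentiation under the integral sign for a `C¹` integrand on a compact interval. -/
theorem hasFDerivAt_intervalIntegral_of_contDiff {E : Type*} [NormedAddCommGroup E]
    [NormedSpace ℝ E] [FiniteDimensional ℝ E] {F : E × ℝ → ℝ} (hF : ContDiff ℝ 1 F)
    (a b : ℝ) (x₀ : E) :
    HasFDerivAt (fun x => ∫ s in a..b, F (x, s))
      (∫ s in a..b, (fderiv ℝ F (x₀, s)).comp (ContinuousLinearMap.inl ℝ E ℝ)) x₀ := by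
  have hcont : Continuous fun p : E × ℝ =>
      (fderiv ℝ F p).comp (ContinuousLinearMap.inl ℝ E ℝ) :=
    (hF.continuous_fderiv one_ne_zero).clm_comp continuous_const
  obtain ⟨C, hC⟩ := ((isCompact_closedBall x₀ 1).prod
    (isCompact_uIcc (a := a) (b := b))).exists_bound_of_continuousOn hcont.continuousOn
  refine intervalIntegral.hasFDerivAt_integral_of_dominated_of_fderiv_le
    (F' := fun x s => (fderiv ℝ F (x, s)).comp (ContinuousLinearMap.inl ℝ E ℝ))
    (bound := fun _ => C) (Metric.closedBall_mem_nhds x₀ one_pos) ?_ ?_ ?_ ?_ ?_ ?_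
  · exact .of_forall fun x => (hF.continuous.comp (by fun_prop)).aestronglyMeasurable
  · exact (hF.continuous.comp (by fun_prop)).intervalIntegrable _ _
  · exact (hcont.comp (by fun_prop : Continuous fun s : ℝ => (x₀, s))).aestronglyMeasurable
  · exact .of_forall fun s hs x hx => hC (x, s) ⟨hx, uIoc_subset_uIcc hs⟩
  · exact intervalIntegrable_const
  · exact .of_forall fun s _ x _ =>
      ((hF.differentiable one_ne_zero) (x, s)).hasFDerivAt.comp x (hasFDerivAt_prodMk_left x s)

theorem contDiff_intervalIntegral {E : Type*} [NormedAddCommGroup E]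
    [NormedSpace ℝ E] [FiniteDimensional ℝ E] (a b : ℝ) (n : ℕ) :
    ∀ {F : E × ℝ → ℝ}, ContDiff ℝ n F → ContDiff ℝ n fun x => ∫ s in a..b, F (x, s) := by
  induction n with
  | zero =>
    intro F hF
    simp only [Nat.cast_zero, contDiff_zero] at hF ⊢
    exact intervalIntegral.continuous_parametric_intervalIntegral_of_continuous'
      (f := fun x s => F (x, s)) hF a b
  | succ n ih =>
    intro F hF
    have hF1 : ContDiff ℝ 1 F := hF.of_le (by exact_mod_cast Nat.le_add_left 1 n)
    push_cast at hF ⊢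
    have hd := hasFDerivAt_intervalIntegral_of_contDiff hF1 a b
    refine contDiff_succ_iff_fderiv_apply.2 ⟨fun x => (hd x).differentiableAt, by simp, fun y => ?_⟩
    have : ContDiff ℝ n fun p : E × ℝ => fderiv ℝ F p (y, 0) :=
      (hF.fderiv_right le_rfl).clm_apply contDiff_const
    convert ih this using 2 with x
    rw [(hd x).fderiv, ContinuousLinearMap.intervalIntegral_apply]
    · simp
    · refine Continuous.intervalIntegrable ?_ _ _
      exact ((hF1.continuous_fderiv one_ne_zero).comp (by fun_prop)).clm_comp continuous_const

/-- Hadamard's lemma: a smooth function vanishing on a hyperplane is divisible by an equation of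
that hyperplane. -/
theorem exists_contDiff_eq_mul_of_eq_zero_on_ker {E : Type*} [NormedAddCommGroup E]
    [NormedSpace ℝ E] [FiniteDimensional ℝ E] {f : E → ℝ} (hf : ContDiff ℝ ∞ f)
    {l : E →L[ℝ] ℝ} {w : E} (hw : l w = 1) (h0 : ∀ y, l y = 0 → f y = 0) :
    ∃ q : E → ℝ, ContDiff ℝ ∞ q ∧ ∀ y, f y = l y * q y := by
  have hfd : Differentiable ℝ f := hf.differentiable (by simp)
  have hD : ContDiff ℝ ∞ fun p : E × ℝ => fderiv ℝ f (p.1 - (p.2 * l p.1) • w) w := by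
    refine ContDiff.clm_apply ((hf.fderiv_right (m := ∞) le_rfl).comp ?_) contDiff_const
    fun_prop
  refine ⟨fun y => ∫ s in (0 : ℝ)..1, fderiv ℝ f (y - (s * l y) • w) w,
    contDiff_infty.2 fun n => contDiff_intervalIntegral 0 1 n
      (contDiff_infty.1 hD n), fun y => ?_⟩
  have hderiv : ∀ s ∈ uIcc (0 : ℝ) 1, HasDerivAt (fun s : ℝ => f (y - (s * l y) • w))
      (-(l y * fderiv ℝ f (y - (s * l y) • w) w)) s := by
    intro s _
    have h1 : HasDerivAt (fun s : ℝ => y - (s * l y) • w) (-((1 * l y) • w)) s :=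
      (((hasDerivAt_id s).mul_const (l y)).smul_const w).const_sub y
    exact ((hfd _).hasFDerivAt.comp_hasDerivAt s h1).congr_deriv (by simp)
  have hint : IntervalIntegrable (fun s : ℝ => -(l y * fderiv ℝ f (y - (s * l y) • w) w))
      MeasureTheory.volume 0 1 := by
    refine Continuous.intervalIntegrable ?_ _ _
    exact (continuous_const.mul (hD.continuous.comp
      (by fun_prop : Continuous fun s : ℝ => (y, s)))).neg
  have := intervalIntegral.integral_eq_sub_of_hasDerivAt hderiv hint
  rw [intervalIntegral.integral_neg, intervalIntegral.integral_const_mul,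
    h0 (y - (1 * l y) • w) (by simp [hw])] at this
  simp at this
  linarith

/-- Local form of Hadamard's lemma. -/
theorem exists_contDiffOn_eq_mul_of_eq_zero_on_ker {E : Type*} [NormedAddCommGroup E]
    [NormedSpace ℝ E] [FiniteDimensional ℝ E] {f : E → ℝ} {U : Set E} (hU : IsOpen U)
    (hf : ContDiffOn ℝ ∞ f U) {l : E →L[ℝ] ℝ} {w : E} (hw : l w = 1)
    (h0 : ∀ y ∈ U, l y = 0 → f y = 0) {x : E} (hx : x ∈ U) :
    ∃ q : E → ℝ, ContDiff ℝ ∞ q ∧ ∀ᶠ y in 𝓝 x, f y = l y * q y := by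
  obtain ⟨r, hr, hrU⟩ := Metric.isOpen_iff.1 hU x hx
  let χ : ContDiffBump x := ⟨r / 4, r / 2, by linarith, by linarith⟩
  have hsupp : tsupport χ ⊆ U := by
    rw [χ.tsupport_eq]
    exact (Metric.closedBall_subset_ball (by simp [χ]; linarith)).trans hrU
  have hg : ContDiff ℝ ∞ fun y => χ y * f y := by
    refine contDiff_iff_contDiffAt.2 fun y => ?_
    by_cases hy : y ∈ tsupport χ
    · exact χ.contDiff.contDiffAt.mul (hf.contDiffAt (hU.mem_nhds (hsupp hy)))
    · refine contDiffAt_const (c := (0 : ℝ)) |>.congr_of_eventuallyEq ?_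
      filter_upwards [notMem_tsupport_iff_eventuallyEq.1 hy] with z hz
      simp [hz]
  obtain ⟨q, hq, hfq⟩ := exists_contDiff_eq_mul_of_eq_zero_on_ker hg hw fun y hy => by
    by_cases hyU : y ∈ U
    · simp [h0 y hyU hy]
    · simp [image_eq_zero_of_notMem_tsupport fun h => hyU (hsupp h)]
  refine ⟨q, hq, χ.eventuallyEq_one.mono fun y hy => ?_⟩
  rw [← hfq, hy]
  simp

/-- A smooth function becomes linear in suitable smooth coordinates around a regular point. -/
theorem exists_openPartialHomeomorph_straightening {E : Type*} [NormedAddCommGroup E]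
    [NormedSpace ℝ E] [CompleteSpace E] {f : E → ℝ} {U : Set E} (hU : IsOpen U)
    (hf : ContDiffOn ℝ ∞ f U) {x : E} (hx : x ∈ U) (hfx : fderiv ℝ f x ≠ 0) :
    ∃ (φ : OpenPartialHomeomorph E E) (l : E →L[ℝ] ℝ) (w : E), l w = 1 ∧ x ∈ φ.source ∧
      φ.source ⊆ U ∧ ContDiffOn ℝ ∞ φ φ.source ∧ ContDiffOn ℝ ∞ φ.symm φ.target ∧
      ∀ y, l (φ y) = f y := by
  obtain ⟨w₀, hw₀⟩ : ∃ w, fderiv ℝ f x w ≠ 0 := by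
    contrapose! hfx
    ext w
    simpa using hfx w
  set l := fderiv ℝ f x with hl
  set w := (l w₀)⁻¹ • w₀ with hw
  have hlw : l w = 1 := by simp [hw, hw₀]
  let g : E → E := fun y => y + (f y - l y) • w
  have hg : ContDiffOn ℝ ∞ g U :=
    contDiffOn_id.add ((hf.sub l.contDiff.contDiffOn).smul contDiffOn_const)
  have hfd : HasFDerivAt f l x :=
    ((hf.contDiffAt (hU.mem_nhds hx)).differentiableAt (by simp)).hasFDerivAt
  have hgx : HasFDerivAt g ((ContinuousLinearEquiv.refl ℝ E : E ≃L[ℝ] E) : E →L[ℝ] E) x := by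
    have := (hasFDerivAt_id x).add ((hfd.sub l.hasFDerivAt).smul_const w)
    refine this.congr_fderiv ?_
    ext; simp
  let φ₀ := (hg.contDiffAt (hU.mem_nhds hx)).toOpenPartialHomeomorph g hgx (by simp)
  have hopen : IsOpen (U ∩ fderiv ℝ g ⁻¹' range ((↑) : (E ≃L[ℝ] E) → E →L[ℝ] E)) :=
    (hg.continuousOn_fderiv_of_isOpen hU (by simp)).isOpen_inter_preimage hU
      ContinuousLinearEquiv.isOpen
  let φ := φ₀.restrOpen _ hopen
  have hφ : ∀ y, φ y = g y := fun y => rfl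
  have hsource : φ.source ⊆ U ∩ fderiv ℝ g ⁻¹' range ((↑) : (E ≃L[ℝ] E) → E →L[ℝ] E) :=
    fun y hy => hy.2
  refine ⟨φ, l, w, hlw, ⟨?_, hx, ?_⟩, fun y hy => (hsource hy).1,
    hg.mono fun y hy => (hsource hy).1, fun y hy => ?_, fun y => ?_⟩
  · exact ContDiffAt.mem_toOpenPartialHomeomorph_source _ _ _
  · exact ⟨_, hgx.fderiv.symm⟩
  · obtain ⟨hyU, e, he⟩ := hsource (φ.map_target hy)
    have hd := hg.contDiffAt (hU.mem_nhds hyU)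
    refine (φ.contDiffAt_symm (f₀' := e) hy ?_ hd).contDiffWithinAt
    rw [he]
    exact (hd.differentiableAt (by simp)).hasFDerivAt
  · simp [hφ, g, hlw]

/-- If `f₁` is a local defining function of the open set `A` near the boundary point `x` and `f₂`
vanishes on the boundary of `A`, then `f₁` divides `f₂` near `x`. -/
theorem exists_eventually_eq_mul_of_eq_zero_on_frontier {E : Type*} [NormedAddCommGroup E]
    [NormedSpace ℝ E] [FiniteDimensional ℝ E] {f₁ f₂ : E → ℝ} {A U : Set E} (hA : IsOpen A)
    (hU : IsOpen U) (hf₁ : ContDiffOn ℝ ∞ f₁ U) (hf₂ : ContDiffOn ℝ ∞ f₂ U)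
    (hpos : ∀ y ∈ A ∩ U, 0 < f₁ y) (hz₁ : ∀ y ∈ frontier A ∩ U, f₁ y = 0)
    (hz₂ : ∀ y ∈ frontier A ∩ U, f₂ y = 0) {x : E} (hxA : x ∈ frontier A) (hx : x ∈ U)
    (hfx : fderiv ℝ f₁ x ≠ 0) :
    ∃ (W : Set E) (q : E → ℝ), IsOpen W ∧ x ∈ W ∧ W ⊆ U ∧ ContDiffOn ℝ ∞ q W ∧
      ∀ y ∈ W, f₂ y = f₁ y * q y := by
  have : CompleteSpace E := FiniteDimensional.complete ℝ E
  obtain ⟨φ, l, w, hlw, hxφ, hφU, hφ, hsymm, hl⟩ :=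
    exists_openPartialHomeomorph_straightening hU hf₁ hx hfx
  obtain ⟨r, hr, hB⟩ := Metric.isOpen_iff.1 φ.open_target _ (φ.map_source hxφ)
  set B := Metric.ball (φ x) r with hBdef
  have hlsymm : ∀ y ∈ B, f₁ (φ.symm y) = l y := fun y hy => by
    rw [← hl, φ.right_inv (hB hy)]
  have hsymmU : ∀ y ∈ B, φ.symm y ∈ U := fun y hy => hφU (φ.map_target (hB hy))
  have hxB : φ x ∈ B := Metric.mem_ball_self hr
  rw [hA.frontier_eq] at hxA hz₁ hz₂
  have hhalf : φ.symm '' (B ∩ {y | 0 < l y}) ⊆ A := by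
    have hconv : Convex ℝ (B ∩ {y | 0 < l y}) :=
      (convex_ball _ _).inter (convex_halfSpace_gt l.isLinear 0)
    have hpre : IsPreconnected (φ.symm '' (B ∩ {y | 0 < l y})) :=
      hconv.isPreconnected.image _
        (φ.continuousOn_symm.mono (inter_subset_left.trans hB))
    refine hpre.subset_left_of_subset_union hA isClosed_closure.isOpen_compl
      (disjoint_compl_right.mono_left subset_closure) ?_ ?_
    · rintro _ ⟨y, ⟨hy, hly⟩, rfl⟩
      by_contra h
      simp only [mem_union, mem_compl_iff, not_or, not_not] at h
      have := hz₁ _ ⟨⟨h.2, h.1⟩, hsymmU y hy⟩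
      rw [hlsymm y hy] at this
      exact hly.ne' this
    · obtain ⟨a, ⟨haφ, haB⟩, haA⟩ := mem_closure_iff.1 hxA.1 _
        (φ.isOpen_inter_preimage (Metric.isOpen_ball (x := φ x) (ε := r))) ⟨hxφ, hxB⟩
      refine ⟨a, ⟨φ a, ⟨haB, ?_⟩, φ.left_inv haφ⟩, haA⟩
      rw [mem_ofPred_eq, hl]
      exact hpos a ⟨haA, hφU haφ⟩
  have hker : ∀ y ∈ B, l y = 0 → f₂ (φ.symm y) = 0 := by
    intro y hy hly
    refine hz₂ _ ⟨⟨?_, fun h => ?_⟩, hsymmU y hy⟩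
    · have hlim : Filter.Tendsto (fun t : ℝ => y + t • w) (𝓝[>] 0) (𝓝 y) := by
        have : Continuous fun t : ℝ => y + t • w := by fun_prop
        simpa using (this.tendsto 0).mono_left nhdsWithin_le_nhds
      refine mem_closure_of_tendsto ((φ.continuousAt_symm (hB hy)).tendsto.comp hlim) ?_
      filter_upwards [hlim.eventually (Metric.isOpen_ball.mem_nhds hy), self_mem_nhdsWithin]
        with t htB ht
      exact hhalf ⟨_, ⟨htB, by simpa [hly, hlw] using ht⟩, rfl⟩
    · have := hpos _ ⟨h, hsymmU y hy⟩
      rw [hlsymm y hy, hly] at this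
      exact this.false
  obtain ⟨Q, hQ, hev⟩ := exists_contDiffOn_eq_mul_of_eq_zero_on_ker Metric.isOpen_ball
    (hf₂.comp (hsymm.mono hB) hsymmU) hlw hker hxB
  obtain ⟨W, hW, hWopen, hxW⟩ := eventually_nhds_iff.1 hev
  refine ⟨φ.source ∩ φ ⁻¹' W, Q ∘ φ, φ.isOpen_inter_preimage hWopen, ⟨hxφ, hxW⟩,
    inter_subset_left.trans hφU, hQ.comp_contDiffOn (hφ.mono inter_subset_left), ?_⟩
  rintro y ⟨hy, hyW⟩
  have := hW _ hyW
  rwa [Function.comp_apply, φ.left_inv hy, hl] at this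

theorem fderiv_smul_of_posHom2 {L : V → ℝ} {U : Set V} (hU : IsOpen U) (hL : PosHom2 L U)
    {v : V} (hv : v ∈ U) {c : ℝ} (hc : 0 < c) :
    fderiv ℝ L (c • v) = c • fderiv ℝ L v := by
  have h : (L <| c • ·) =ᶠ[𝓝 v] fun x => c ^ 2 • L x := by
    filter_upwards [hU.mem_nhds hv] with x hx using hL x hx c hc
  have h' := h.fderiv_eq (𝕜 := ℝ)
  rw [fderiv_comp_smul, show (fun x => c ^ 2 • L x) = c ^ 2 • L from rfl, fderiv_const_smul_field,
    pow_two, mul_smul] at h'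
  exact smul_right_injective _ hc.ne' h'

theorem fundTensor_self_left {L : V → ℝ} {U : Set V} (hU : IsOpen U)
    (hL : PosHom2 L U) (hs : ContDiffOn ℝ ∞ L U) {v : V} (hv : v ∈ U) (w : V) :
    fundTensor L v v w = (1 / 2 : ℝ) * fderiv ℝ L v w := by
  have hd : DifferentiableAt ℝ (fderiv ℝ L) v :=
    ((hs.fderiv_of_isOpen hU (m := 1) (by norm_cast)).contDiffAt
      (hU.mem_nhds hv)).differentiableAt one_ne_zero
  have h₁ : HasDerivAt (fun c : ℝ => c • v) v 1 := by
    simpa using (hasDerivAt_id (1 : ℝ)).smul_const v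
  have h₂ : HasDerivAt (fun c : ℝ => fderiv ℝ L (c • v)) (fderiv ℝ (fderiv ℝ L) v v) 1 := by
    have hd' : HasFDerivAt (fderiv ℝ L) (fderiv ℝ (fderiv ℝ L) v) ((1 : ℝ) • v) := by
      simpa using hd.hasFDerivAt
    exact hd'.comp_hasDerivAt 1 h₁
  have h₃ : HasDerivAt (fun c : ℝ => c • fderiv ℝ L v) (fderiv ℝ L v) 1 := by
    simpa using (hasDerivAt_id (1 : ℝ)).smul_const (fderiv ℝ L v)
  have h₄ : (fun c : ℝ => fderiv ℝ L (c • v)) =ᶠ[𝓝 1] fun c => c • fderiv ℝ L v := by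
    filter_upwards [lt_mem_nhds one_pos] with c hc using fderiv_smul_of_posHom2 hU hL hv hc
  rw [fundTensor, h₂.unique (h₃.congr_of_eventuallyEq h₄)]

theorem conic_closure_diff_zero {A : Set V} (hA : Conic A) : Conic (closure A \ {0}) := by
  rintro v ⟨hv, hv0⟩ c hc
  refine ⟨?_, smul_ne_zero hc.ne' hv0⟩
  exact map_mem_closure (continuous_const_smul c) hv fun a ha => hA a ha c hc

namespace IsProperLMNorm

variable {L L₁ L₂ : V → ℝ} {A : Set V}

theorem fundTensor_self_left (h : IsProperLMNorm L A) {v : V} (hv : v ∈ closure A \ {0})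
    (w : V) : fundTensor L v v w = (1 / 2 : ℝ) * fderiv ℝ L v w := by
  obtain ⟨U, hU, -, -, hsub, hs, hL⟩ := h.smooth_ext
  exact _root_.fundTensor_self_left hU hL hs (hsub hv) w

theorem fderiv_smul (h : IsProperLMNorm L A) {v : V} (hv : v ∈ closure A \ {0}) {c : ℝ}
    (hc : 0 < c) : fderiv ℝ L (c • v) = c • fderiv ℝ L v := by
  obtain ⟨U, hU, -, -, hsub, -, hL⟩ := h.smooth_ext
  exact fderiv_smul_of_posHom2 hU hL (hsub hv) hc

theorem map_smul (h : IsProperLMNorm L A) {v : V} (hv : v ∈ closure A \ {0}) {c : ℝ}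
    (hc : 0 < c) : L (c • v) = c ^ 2 * L v := by
  obtain ⟨U, -, -, -, hsub, -, hL⟩ := h.smooth_ext
  exact hL v (hsub hv) c hc

theorem fderiv_ne_zero (h : IsProperLMNorm L A) {v : V} (hv : v ∈ closure A \ {0}) :
    fderiv ℝ L v ≠ 0 := fun h0 =>
  hv.2 ((h.lorentz v hv).1 v fun w => by simp [h.fundTensor_self_left hv, h0])

theorem smul_mem_iff (h : IsProperLMNorm L A) {v : V} {c : ℝ} (hc : 0 < c) :
    c • v ∈ A ↔ v ∈ A := by
  refine ⟨fun hv => ?_, fun hv => h.conic v hv c hc⟩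
  simpa [smul_smul, hc.ne'] using h.conic _ hv c⁻¹ (inv_pos.2 hc)

/-- `m` is a conformal factor between `L₁` and `L₂` at `v`: it relates their values and, at points
outside `A`, where both values may vanish, also their differentials. -/
def IsFactorAt (L₁ L₂ : V → ℝ) (A : Set V) (v : V) (m : ℝ) : Prop :=
  0 < m ∧ L₂ v = m * L₁ v ∧ (v ∉ A → fderiv ℝ L₂ v = m • fderiv ℝ L₁ v)

theorem isFactorAt_div (h₁ : IsProperLMNorm L₁ A) (h₂ : IsProperLMNorm L₂ A) {v : V}
    (hv : v ∈ A) : IsFactorAt L₁ L₂ A v (L₂ v / L₁ v) :=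
  ⟨div_pos (h₂.pos v hv) (h₁.pos v hv), (div_mul_cancel₀ _ (h₁.pos v hv).ne').symm,
    fun h => (h hv).elim⟩

theorem isFactorAt_unique (h₁ : IsProperLMNorm L₁ A) {v : V} (hv : v ∈ closure A \ {0})
    {m m' : ℝ} (hm : IsFactorAt L₁ L₂ A v m) (hm' : IsFactorAt L₁ L₂ A v m') : m = m' := by
  by_cases hvA : v ∈ A
  · exact mul_right_cancel₀ (h₁.pos v hvA).ne' (hm.2.1.symm.trans hm'.2.1)
  · exact smul_left_injective ℝ (h₁.fderiv_ne_zero hv)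
      ((hm.2.2 hvA).symm.trans (hm'.2.2 hvA))

theorem isFactorAt_smul (h₁ : IsProperLMNorm L₁ A) (h₂ : IsProperLMNorm L₂ A) {v : V}
    (hv : v ∈ closure A \ {0}) {m : ℝ} (hm : IsFactorAt L₁ L₂ A v m) {c : ℝ} (hc : 0 < c) :
    IsFactorAt L₁ L₂ A (c • v) m := by
  refine ⟨hm.1, ?_, fun hcv => ?_⟩
  · rw [h₁.map_smul hv hc, h₂.map_smul hv hc, hm.2.1]
    ring
  · rw [h₁.fderiv_smul hv hc, h₂.fderiv_smul hv hc,
      hm.2.2 fun h => hcv ((h₁.smul_mem_iff hc).2 h), smul_comm]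

/-- Near each boundary point the conformal factor is given by a smooth function. -/
theorem exists_smooth_isFactorAt_of_notMem [FiniteDimensional ℝ V] (h₁ : IsProperLMNorm L₁ A)
    (h₂ : IsProperLMNorm L₂ A) {v : V} (hv : v ∈ closure A \ {0}) (hvA : v ∉ A) :
    ∃ q : V → ℝ, ContDiffAt ℝ ∞ q v ∧
      ∀ᶠ x in 𝓝[closure A \ {0}] v, IsFactorAt L₁ L₂ A x (q x) := by
  obtain ⟨U₁, hU₁, -, h0, hsub₁, hs₁, -⟩ := h₁.smooth_ext
  obtain ⟨U₂, hU₂, -, -, hsub₂, hs₂, -⟩ := h₂.smooth_ext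
  have hfr : ∀ y ∈ frontier A ∩ (U₁ ∩ U₂), y ∈ (closure A \ {0}) \ A := fun y hy =>
    have hy' := h₁.isOpen.frontier_eq ▸ hy.1
    ⟨⟨hy'.1, fun hy0 => h0 (hy0 ▸ hy.2.1)⟩, hy'.2⟩
  obtain ⟨W, q, hW, hvW, hWU, hq, hmul⟩ := exists_eventually_eq_mul_of_eq_zero_on_frontier
    h₁.isOpen (hU₁.inter hU₂) (hs₁.mono inter_subset_left) (hs₂.mono inter_subset_right)
    (fun y hy => h₁.pos y hy.1) (fun y hy => h₁.zero_on_bd y (hfr y hy))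
    (fun y hy => h₂.zero_on_bd y (hfr y hy)) (h₁.isOpen.frontier_eq ▸ ⟨hv.1, hvA⟩)
    ⟨hsub₁ hv, hsub₂ hv⟩ (h₁.fderiv_ne_zero hv)
  have hfderiv : ∀ x ∈ W, x ∈ closure A \ {0} → x ∉ A →
      fderiv ℝ L₂ x = q x • fderiv ℝ L₁ x := by
    intro x hxW hx hxA
    have heq : L₂ =ᶠ[𝓝 x] fun y => L₁ y * q y := by
      filter_upwards [hW.mem_nhds hxW] with y hy using hmul y hy
    have hL₁ : DifferentiableAt ℝ L₁ x :=
      (hs₁.contDiffAt (hU₁.mem_nhds (hsub₁ hx))).differentiableAt (by simp)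
    have hqx : DifferentiableAt ℝ q x :=
      (hq.contDiffAt (hW.mem_nhds hxW)).differentiableAt (by simp)
    rw [heq.fderiv_eq, fderiv_fun_mul hL₁ hqx, h₁.zero_on_bd x ⟨hx, hxA⟩, zero_smul, zero_add]
  have hqv := hq.contDiffAt (hW.mem_nhds hvW)
  have hqpos : 0 < q v := by
    refine lt_of_le_of_ne ?_ fun h => h₂.fderiv_ne_zero hv (by
      rw [hfderiv v hvW hv hvA, ← h, zero_smul])
    by_contra! hneg
    obtain ⟨a, haA, hqa, haW⟩ := ((mem_closure_iff_frequently.1 hv.1).and_eventually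
      ((hqv.continuousAt.eventually_lt_const hneg).and (hW.mem_nhds hvW))).exists
    have h₂a := h₂.pos a haA
    rw [hmul a haW] at h₂a
    exact h₂a.not_ge (mul_nonpos_of_nonneg_of_nonpos (h₁.pos a haA).le hqa.le)
  refine ⟨q, hqv, ?_⟩
  filter_upwards [nhdsWithin_le_nhds (hW.mem_nhds hvW), self_mem_nhdsWithin,
    nhdsWithin_le_nhds (hqv.continuousAt.eventually_const_lt hqpos)] with x hxW hx hqx
  exact ⟨hqx, by rw [hmul x hxW, mul_comm], hfderiv x hxW hx⟩

theorem exists_smooth_isFactorAt [FiniteDimensional ℝ V] (h₁ : IsProperLMNorm L₁ A)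
    (h₂ : IsProperLMNorm L₂ A) {v : V} (hv : v ∈ closure A \ {0}) :
    ∃ q : V → ℝ, ContDiffAt ℝ ∞ q v ∧
      ∀ᶠ x in 𝓝[closure A \ {0}] v, IsFactorAt L₁ L₂ A x (q x) := by
  by_cases hvA : v ∈ A
  · obtain ⟨U₁, hU₁, -, -, hsub₁, hs₁, -⟩ := h₁.smooth_ext
    obtain ⟨U₂, hU₂, -, -, hsub₂, hs₂, -⟩ := h₂.smooth_ext
    refine ⟨fun x => L₂ x / L₁ x, (hs₂.contDiffAt (hU₂.mem_nhds (hsub₂ hv))).div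
      (hs₁.contDiffAt (hU₁.mem_nhds (hsub₁ hv))) (h₁.pos v hvA).ne', ?_⟩
    filter_upwards [nhdsWithin_le_nhds (h₁.isOpen.mem_nhds hvA)] with x hx
    exact isFactorAt_div h₁ h₂ hx
  · exact exists_smooth_isFactorAt_of_notMem h₁ h₂ hv hvA

end IsProperLMNorm

/-- two properly Lorentz-Minkowski norms with the same cone domain are
anisotropically equivalent, and the factor on the boundary cone is computed from the
fundamental tensors. -/
theorem stmt_0 [FiniteDimensional ℝ V] (hn : 2 ≤ finrank ℝ V)
    (L1 L2 : V → ℝ) (A : Set V)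
    (h1 : IsProperLMNorm L1 A) (h2 : IsProperLMNorm L2 A) :
    ∃ μ : V → ℝ,
      ContDiffOn ℝ (⊤ : ℕ∞) μ (closure A \ {0}) ∧
      (∀ v ∈ closure A \ {0}, 0 < μ v) ∧
      PosHom0 μ (closure A \ {0}) ∧
      (∀ v ∈ closure A \ {0}, L2 v = μ v * L1 v) ∧
      (∀ v ∈ (closure A \ {0}) \ A,
        (∃ w : V, fundTensor L1 v v w ≠ 0) ∧
        (∀ w : V, fundTensor L1 v v w ≠ 0 →
          fundTensor L2 v v w ≠ 0 ∧
          μ v = fundTensor L2 v v w / fundTensor L1 v v w)) := by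
  have hex : ∀ v, ∃ m, v ∈ closure A \ {0} → IsProperLMNorm.IsFactorAt L1 L2 A v m := by
    intro v
    by_cases hv : v ∈ closure A \ {0}
    · obtain ⟨q, -, hq⟩ := h1.exists_smooth_isFactorAt h2 hv
      exact ⟨q v, fun _ => hq.self_of_nhdsWithin hv⟩
    · exact ⟨0, fun h => (hv h).elim⟩
  choose μ hμ using hex
  refine ⟨μ, fun v hv => ?_, fun v hv => (hμ v hv).1, fun v hv c hc => ?_,
    fun v hv => (hμ v hv).2.1, fun v hv => ⟨?_, fun w hw => ?_⟩⟩
  · obtain ⟨q, hqv, hq⟩ := h1.exists_smooth_isFactorAt h2 hv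
    refine hqv.contDiffWithinAt.congr_of_eventuallyEq_of_mem ?_ hv
    filter_upwards [hq, self_mem_nhdsWithin] with x hx hxA
    exact h1.isFactorAt_unique hxA (hμ x hxA) hx
  · have hcv := conic_closure_diff_zero h1.conic v hv c hc
    exact h1.isFactorAt_unique hcv (hμ _ hcv) (h1.isFactorAt_smul h2 hv (hμ v hv) hc)
  · by_contra! h
    exact hv.1.2 ((h1.lorentz v hv.1).1 v h)
  · have hg : fundTensor L2 v v w = μ v * fundTensor L1 v v w := by
      rw [h1.fundTensor_self_left hv.1, h2.fundTensor_self_left hv.1, (hμ v hv.1).2.2 hv.2,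
        smul_apply, smul_eq_mul, mul_left_comm]
    rw [hg]
    exact ⟨mul_ne_zero (hμ v hv.1).1.ne' hw, (mul_div_cancel_right₀ _ hw).symm⟩
end
end

section
/- Let F̂ be a Minkowski norm on V with fundamental tensor ĝ_v (of F̂²), and let ω : V → ℝ be a linear form. Define L(v) := ω(v)² − F̂(v)² for v ≠ 0; then the fundamental tensor of L at v equals g_v(u,u') = ω(u)·ω(u') − ĝ_v(u,u'). Assume the transversality condition: for every v ≠ 0 with ω(v) = F̂(v) there exists w ∈ ker ω with ĝ_v(v,w) ≠ 0. Then for every v ∈ V ∖ {0} with ω(v) ≥ F̂(v), the bilinear form g_v is nondegenerate with index n−1 (Lorentzian); thus L is positive on {v ≠ 0 : ω(v) > F̂(v)}, vanishes on {v ≠ 0 : ω(v) = F̂(v)}, and has Lorentzian fundamental tensor on the whole region {v ≠ 0 : ω(v) ≥ F̂(v)}. -/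
open Set Module

noncomputable section

variable {V : Type*} [NormedAddCommGroup V] [NormedSpace ℝ V]

/-- Positively 1-homogeneous on a set. -/
def PosHom1 (F : V → ℝ) (s : Set V) : Prop :=
  ∀ v ∈ s, ∀ c : ℝ, 0 < c → F (c • v) = c * F v

/-- A Minkowski norm on `V`: smooth, positively 1-homogeneous, positive away from `0`,
with positive definite fundamental tensor of `F²`. -/
structure IsMinkowskiNorm (F : V → ℝ) : Prop where
  pos : ∀ v : V, v ≠ 0 → 0 < F v
  smooth : ContDiffOn ℝ (⊤ : ℕ∞) F {0}ᶜ
  hom : PosHom1 F {0}ᶜ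
  posdef : ∀ v : V, v ≠ 0 → ∀ u : V, u ≠ 0 →
    0 < fundTensor (fun x => F x ^ 2) v u u

open Topology

theorem PosHom1.fderiv_sq_apply_self {F : V → ℝ} (hF : PosHom1 F {0}ᶜ) {x : V} (hx : x ≠ 0)
    (hd : DifferentiableAt ℝ (fun y => F y ^ 2) x) :
    fderiv ℝ (fun y => F y ^ 2) x x = 2 * F x ^ 2 := by
  have hray : HasDerivAt (fun c : ℝ => c • x) x 1 := by
    simpa using (hasDerivAt_id (1 : ℝ)).smul_const x
  have hleft : HasDerivAt (fun c : ℝ => F (c • x) ^ 2) (fderiv ℝ (fun y => F y ^ 2) x x) 1 := by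
    have hd' : HasFDerivAt (fun y => F y ^ 2) (fderiv ℝ (fun y => F y ^ 2) x) ((1 : ℝ) • x) := by
      simpa using hd.hasFDerivAt
    exact hd'.comp_hasDerivAt (1 : ℝ) hray
  have hright : HasDerivAt (fun c : ℝ => c ^ 2 * F x ^ 2) (2 * F x ^ 2) 1 := by
    simpa using (hasDerivAt_pow 2 (1 : ℝ)).mul_const (F x ^ 2)
  refine hleft.unique (hright.congr_of_eventuallyEq ?_)
  filter_upwards [lt_mem_nhds (zero_lt_one' ℝ)] with c hc
  rw [hF x hx c hc, mul_pow]

namespace IsMinkowskiNorm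

variable {F : V → ℝ}

theorem contDiffAt_sq (hF : IsMinkowskiNorm F) {v : V} (hv : v ≠ 0) :
    ContDiffAt ℝ 2 (fun x => F x ^ 2) v :=
  ((hF.smooth.contDiffAt (isOpen_compl_singleton.mem_nhds hv)).of_le
    (WithTop.coe_le_coe.mpr (le_top : (2 : ℕ∞) ≤ ⊤))).pow 2

theorem differentiableAt_sq (hF : IsMinkowskiNorm F) {v : V} (hv : v ≠ 0) :
    DifferentiableAt ℝ (fun x => F x ^ 2) v :=
  (hF.contDiffAt_sq hv).differentiableAt (by norm_num)

theorem differentiableAt_fderiv_sq (hF : IsMinkowskiNorm F) {v : V} (hv : v ≠ 0) :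
    DifferentiableAt ℝ (fderiv ℝ (fun x => F x ^ 2)) v :=
  ((hF.contDiffAt_sq hv).fderiv_right (m := 1) (by norm_num)).differentiableAt (by norm_num)

theorem fundTensor_comm (hF : IsMinkowskiNorm F) {v : V} (hv : v ≠ 0) (u w : V) :
    fundTensor (fun x => F x ^ 2) v u w = fundTensor (fun x => F x ^ 2) v w u := by
  have h := (hF.contDiffAt_sq hv).isSymmSndFDerivAt (by simp)
  simp only [fundTensor, h.eq u w]

theorem fundTensor_self (hF : IsMinkowskiNorm F) {v : V} (hv : v ≠ 0) :
    fundTensor (fun x => F x ^ 2) v v v = F v ^ 2 := by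
  have hleft := (hF.differentiableAt_fderiv_sq hv).hasFDerivAt.clm_apply (hasFDerivAt_id v)
  have hright := (hF.differentiableAt_sq hv).hasFDerivAt.const_mul 2
  have heq : (fun x => fderiv ℝ (fun y => F y ^ 2) x (id x)) =ᶠ[𝓝 v] fun x => 2 * F x ^ 2 := by
    filter_upwards [isOpen_compl_singleton.mem_nhds hv] with x hx
    exact hF.hom.fderiv_sq_apply_self hx (hF.differentiableAt_sq hx)
  have h := DFunLike.congr_fun (hleft.unique (hright.congr_of_eventuallyEq heq)) v
  have hv' := hF.hom.fderiv_sq_apply_self hv (hF.differentiableAt_sq hv)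
  simp [hv'] at h
  simp only [fundTensor]
  linarith

theorem fundTensor_sq_sub_sq (hF : IsMinkowskiNorm F) (ω : V →L[ℝ] ℝ) {v : V} (hv : v ≠ 0)
    (u w : V) :
    fundTensor (fun x => ω x ^ 2 - F x ^ 2) v u w =
      ω u * ω w - fundTensor (fun x => F x ^ 2) v u w := by
  have heq : fderiv ℝ (fun x => ω x ^ 2 - F x ^ 2) =ᶠ[𝓝 v]
      fun x => (2 * ω x) • ω - fderiv ℝ (fun y => F y ^ 2) x := by
    filter_upwards [isOpen_compl_singleton.mem_nhds hv] with x hx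
    have h := (ω.hasFDerivAt.pow 2).fun_sub (hF.differentiableAt_sq hx).hasFDerivAt
    simpa using h.fderiv
  have h : HasFDerivAt (fun x => (2 * ω x) • ω - fderiv ℝ (fun y => F y ^ 2) x) _ v :=
    ((ω.hasFDerivAt.const_mul 2).smul_const ω).sub
      (hF.differentiableAt_fderiv_sq hv).hasFDerivAt
  simp only [fundTensor, heq.fderiv_eq, h.fderiv]
  simp
  ring

theorem isLorentzForm_mul_sub_fundTensor [FiniteDimensional ℝ V] (hF : IsMinkowskiNorm F)
    (ω : V →ₗ[ℝ] ℝ) {v : V} (hv : v ≠ 0) (hle : F v ≤ ω v)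
    (htrans : ω v = F v → ∃ w : V, ω w = 0 ∧ fundTensor (fun x => F x ^ 2) v v w ≠ 0) :
    IsLorentzForm fun u w => ω u * ω w - fundTensor (fun x => F x ^ 2) v u w := by
  have hFv := hF.pos v hv
  have hωv : 0 < ω v := hFv.trans_le hle
  constructor
  · intro u hu
    beta_reduce at hu
    by_contra hu0
    have huv := hu v
    have huu := hu u
    have hpos := hF.posdef v hv u hu0
    have hself := hF.fundTensor_self hv
    have hcomm := hF.fundTensor_comm hv u v
    have hexp : ∀ t : ℝ, fundTensor (fun x => F x ^ 2) v (u - t • v) (u - t • v) =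
        ω u ^ 2 - 2 * t * (ω u * ω v) + t ^ 2 * F v ^ 2 := by
      intro t
      have : fundTensor (fun x => F x ^ 2) v (u - t • v) (u - t • v) =
          fundTensor (fun x => F x ^ 2) v u u - t * fundTensor (fun x => F x ^ 2) v u v
            - t * fundTensor (fun x => F x ^ 2) v v u
            + t ^ 2 * fundTensor (fun x => F x ^ 2) v v v := by
        simp [fundTensor]
        ring
      rw [this, hself, ← hcomm]
      linear_combination (-1) * huu + 2 * t * huv
    obtain ⟨t, ht⟩ : ∃ t, ω u = t * ω v := ⟨ω u / ω v, by field_simp⟩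
    have hut : u = t • v := by
      by_contra hne
      have hlt := hF.posdef v hv _ (sub_ne_zero.mpr hne)
      rw [hexp t, ht] at hlt
      nlinarith [mul_nonneg (sq_nonneg t) (sub_nonneg.mpr (pow_le_pow_left₀ hFv.le hle 2))]
    have ht0 : t ≠ 0 := by
      rintro rfl
      exact hu0 (by simpa using hut)
    have htv : ∀ w, fundTensor (fun x => F x ^ 2) v u w =
        t * fundTensor (fun x => F x ^ 2) v v w := by
      intro w
      rw [hut]
      simp [fundTensor]
      ring
    have hsq : ω v ^ 2 = F v ^ 2 := by
      refine mul_left_cancel₀ ht0 ?_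
      rw [htv, hself, ht] at huv
      linear_combination huv
    obtain ⟨w, hw, hne⟩ := htrans ((pow_left_inj₀ hωv.le hFv.le two_ne_zero).mp hsq)
    have huw := hu w
    rw [hw, htv] at huw
    exact mul_ne_zero ht0 hne (by linarith)
  · refine ⟨LinearMap.ker ω, ?_, ?_⟩
    · have hω : ω ≠ 0 := by
        rintro rfl
        simp at hωv
      have := Module.Dual.finrank_ker_add_one_of_ne_zero hω
      omega
    · intro u hu hu0
      have hωu : ω u = 0 := hu
      have := hF.posdef v hv u hu0
      simp only [hωu]
      linarith

end IsMinkowskiNorm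

/-- `L = ω² - F̂²` is Lorentz-Finsler on the region `ω ≥ F̂` under the
transversality condition. -/
theorem stmt_1 [FiniteDimensional ℝ V] (hn : 2 ≤ finrank ℝ V)
    (F : V → ℝ) (hF : IsMinkowskiNorm F) (ω : V →ₗ[ℝ] ℝ)
    (L : V → ℝ) (hL : ∀ v : V, L v = (ω v) ^ 2 - F v ^ 2)
    (htrans : ∀ v : V, v ≠ 0 → ω v = F v →
      ∃ w : V, ω w = 0 ∧ fundTensor (fun x => F x ^ 2) v v w ≠ 0) :
    (∀ v : V, v ≠ 0 → ∀ u u' : V,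
      fundTensor L v u u' = ω u * ω u' - fundTensor (fun x => F x ^ 2) v u u') ∧
    (∀ v : V, v ≠ 0 → F v ≤ ω v → IsLorentzForm (fundTensor L v)) ∧
    (∀ v : V, v ≠ 0 → F v < ω v → 0 < L v) ∧
    (∀ v : V, v ≠ 0 → ω v = F v → L v = 0) := by
  obtain rfl : L = fun v => ω v ^ 2 - F v ^ 2 := funext hL
  have hg : ∀ v : V, v ≠ 0 → ∀ u u' : V, fundTensor (fun v => ω v ^ 2 - F v ^ 2) v u u' =
      ω u * ω u' - fundTensor (fun x => F x ^ 2) v u u' := fun v hv u u' =>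
    hF.fundTensor_sq_sub_sq (LinearMap.toContinuousLinearMap ω) hv u u'
  refine ⟨hg, fun v hv hle => ?_, fun v hv hlt => ?_, fun v _ h => ?_⟩
  · rw [show fundTensor (fun v => ω v ^ 2 - F v ^ 2) v =
      fun u u' => ω u * ω u' - fundTensor (fun x => F x ^ 2) v u u' from
        funext₂ (hg v hv)]
    exact hF.isLorentzForm_mul_sub_fundTensor ω hv hle (htrans v hv)
  · exact sub_pos.mpr (pow_lt_pow_left₀ hlt (hF.pos v hv).le two_ne_zero)
  · simp [h]
end
end

section
/- Let A ⊆ V ∖ {0} be a nonempty open connected conic set, Ā its closure in V ∖ {0} and C := Ā ∖ A. Let g_R be a positive definite symmetric bilinear form on V and F̂ a conic Minkowski norm defined on an open conic set A* ⊇ Ā, with fundamental tensor ĝ_v. Define L(v) := g_R(v,v) − F̂(v)² and assume L > 0 on A and L = 0 on C. Then the fundamental tensor of L is nondegenerate with index n−1 at every v ∈ Ā if and only if both of the following hold: (i) for every v ∈ A and every w ≠ 0 with g_R(v,w) = 0, one has g_R(w,w) − ĝ_v(w,w) − ĝ_v(v,w)²/L(v) < 0; (ii) for every v ∈ C, one has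 g_R(w,w) − ĝ_v(w,w) < 0 for every w ≠ 0 with g_R(v,w) = 0 and ĝ_v(v,w) = 0, and moreover the hyperplanes {w : g_R(v,w) = 0} and {w : ĝ_v(v,w) = 0} are distinct. -/
open Set Module

noncomputable section

variable {V : Type*} [NormedAddCommGroup V] [NormedSpace ℝ V]

/-- A conic Minkowski norm on the open conic set `Astar ⊆ V ∖ {0}`. -/
structure IsConicMinkowski (F : V → ℝ) (Astar : Set V) : Prop where
  isOpen : IsOpen Astar
  conic : Conic Astar
  zero_not_mem : (0 : V) ∉ Astar
  pos : ∀ v ∈ Astar, 0 < F v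
  smooth : ContDiffOn ℝ (⊤ : ℕ∞) F Astar
  hom : PosHom1 F Astar
  posdef : ∀ v ∈ Astar, ∀ u : V, u ≠ 0 → 0 < fundTensor (fun x => F x ^ 2) v u u

namespace LinearMap.BilinForm

variable {E : Type*} [AddCommGroup E] [Module ℝ E] {g : LinearMap.BilinForm ℝ E}

theorem apply_sub_smul_self (hg : ∀ u w, g u w = g w u) (x y : E) (s : ℝ) :
    g (x - s • y) (x - s • y) = g x x - 2 * s * g y x + s ^ 2 * g y y := by
  simp only [map_sub, map_smul, LinearMap.sub_apply, LinearMap.smul_apply, smul_eq_mul, hg x y]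
  ring

end LinearMap.BilinForm

section LorentzForm

open LinearMap.BilinForm

variable {g p : LinearMap.BilinForm ℝ V}

theorem isLorentzForm_of_neg_on_orthogonal [FiniteDimensional ℝ V] {y : V} (hy : 0 < g y y)
    (hneg : ∀ x, g y x = 0 → x ≠ 0 → g x x < 0) (hg : ∀ u w, g u w = g w u) :
    IsLorentzForm (fun u w => g u w) := by
  refine ⟨fun u hu => ?_, LinearMap.ker (g y), ?_, fun u hu hu0 => hneg u hu hu0⟩
  · by_contra hu0
    exact (hneg u (by rw [hg]; exact hu y) hu0).ne (hu u)
  · have hne : g y ≠ 0 := fun h => by simp [h] at hy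
    have := Module.Dual.finrank_ker_add_one_of_ne_zero (f := g y) hne
    omega

theorem IsLorentzForm.neg_of_orthogonal [FiniteDimensional ℝ V]
    (hL : IsLorentzForm (fun u w => g u w))
    (hg : ∀ u w, g u w = g w u) {v u : V} (hv : 0 ≤ g v v) (hvu : g v u = 0)
    (hli : LinearIndependent ℝ ![v, u]) : g u u < 0 := by
  obtain ⟨-, W, hW, hneg⟩ := hL
  by_contra! hu
  have h2 : finrank ℝ (Submodule.span ℝ (range ![v, u])) = 2 := by
    simpa using finrank_span_eq_card hli
  have hpos : 0 < finrank ℝ V :=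
    Nat.lt_of_lt_of_le (by omega) (Submodule.finrank_le (Submodule.span ℝ (range ![v, u])))
  have hsum := Submodule.finrank_sup_add_finrank_inf_eq W (Submodule.span ℝ (range ![v, u]))
  have hle := Submodule.finrank_le (W ⊔ Submodule.span ℝ (range ![v, u]))
  have hne : W ⊓ Submodule.span ℝ (range ![v, u]) ≠ ⊥ := by
    intro h
    rw [h, finrank_bot] at hsum
    omega
  obtain ⟨x, ⟨hxW, hx⟩, hx0⟩ := Submodule.exists_mem_ne_zero_of_ne_bot hne
  rw [Matrix.range_cons_cons_empty] at hx
  obtain ⟨a, b, rfl⟩ := Submodule.mem_span_pair.1 hx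
  have h := hneg _ hxW hx0
  have huv : g u v = 0 := by rw [hg, hvu]
  simp only [map_add, map_smul, LinearMap.add_apply, LinearMap.smul_apply, smul_eq_mul, hvu,
    huv] at h
  nlinarith [mul_nonneg (sq_nonneg a) hv, mul_nonneg (sq_nonneg b) hu]

theorem linearIndependent_pair_of_orthogonal (hp : ∀ x, x ≠ 0 → 0 < p x x) {v u : V}
    (hv : v ≠ 0) (hu : u ≠ 0) (hvu : p v u = 0) : LinearIndependent ℝ ![v, u] := by
  rw [LinearIndependent.pair_iff' hv]
  rintro a rfl
  rw [map_smul, smul_eq_mul, mul_eq_zero, or_iff_left (hp v hv).ne'] at hvu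
  simp [hvu] at hu

/-- The timelike case. -/
theorem isLorentzForm_iff_of_pos [FiniteDimensional ℝ V] (hg : ∀ u w, g u w = g w u)
    (hp : ∀ x, x ≠ 0 → 0 < p x x) {v : V} (hv : 0 < g v v) :
    IsLorentzForm (fun u w => g u w) ↔
      ∀ w, w ≠ 0 → p v w = 0 → g w w - g v w ^ 2 / g v v < 0 := by
  have hv0 : v ≠ 0 := by rintro rfl; simp at hv
  have key (w : V) : g (w - (g v w / g v v) • v) (w - (g v w / g v v) • v) =
      g w w - g v w ^ 2 / g v v := by
    rw [apply_sub_smul_self hg]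
    field_simp
    ring
  constructor
  · intro hL w hw hvw
    rw [← key]
    refine hL.neg_of_orthogonal hg hv.le ?_ ?_
    · simp [hv.ne']
    · have := linearIndependent_pair_of_orthogonal hp hv0 hw hvw
      rw [LinearIndependent.pair_iff] at this ⊢
      intro a b hab
      have h := this (a - b * (g v w / g v v)) b (by rw [← hab]; module)
      obtain ⟨h1, rfl⟩ := h
      simpa using h1
  · intro h
    refine isLorentzForm_of_neg_on_orthogonal hv (fun x hx hx0 => ?_) hg
    have hpv := hp v hv0
    have hw0 : x - (p v x / p v v) • v ≠ 0 := by
      intro h0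
      rw [sub_eq_zero] at h0
      have h1 : g v ((p v x / p v v) • v) = 0 := by rw [← h0, hx]
      rw [map_smul, smul_eq_mul, mul_eq_zero, or_iff_left hv.ne'] at h1
      rw [h1, zero_smul] at h0
      exact hx0 h0
    have := h _ hw0 (by simp [hpv.ne'])
    rw [apply_sub_smul_self hg, map_sub, map_smul, smul_eq_mul, hx] at this
    have e : (0 - p v x / p v v * g v v) ^ 2 / g v v = (p v x / p v v) ^ 2 * g v v := by
      field_simp
      ring
    rw [e] at this
    linarith

/-- The lightlike case. -/
theorem isLorentzForm_iff_of_eq_zero [FiniteDimensional ℝ V] (hg : ∀ u w, g u w = g w u)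
    (hp : ∀ x, x ≠ 0 → 0 < p x x) {v : V} (hv0 : v ≠ 0) (hv : g v v = 0) :
    IsLorentzForm (fun u w => g u w) ↔
      (∀ w, w ≠ 0 → p v w = 0 → g v w = 0 → g w w < 0) ∧ g v ≠ 0 := by
  constructor
  · refine fun hL => ⟨fun w hw hpw hgw => hL.neg_of_orthogonal hg hv.ge hgw
      (linearIndependent_pair_of_orthogonal hp hv0 hw hpw), fun h => hv0 (hL.1 v fun w => ?_)⟩
    simp [h]
  · rintro ⟨hneg, hne⟩
    obtain ⟨u, hu⟩ : ∃ u, g v u ≠ 0 := by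
      by_contra! h
      exact hne (LinearMap.ext h)
    obtain ⟨y, hy, hvy⟩ : ∃ y, 0 < g y y ∧ g v y ≠ 0 := by
      refine ⟨u - ((g u u - 1) / (2 * g v u)) • v, ?_, by simpa [hv] using hu⟩
      have : g (u - ((g u u - 1) / (2 * g v u)) • v) (u - ((g u u - 1) / (2 * g v u)) • v) = 1 := by
        rw [apply_sub_smul_self hg, hv]
        field_simp
        ring
      rw [this]
      exact one_pos
    have hpv := hp v hv0
    have hker (x : V) (hx : g v x = 0) : g x x ≤ 0 ∧ (g x x = 0 → ∃ c : ℝ, x = c • v) := by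
      by_cases h0 : x - (p v x / p v v) • v = 0
      · rw [sub_eq_zero] at h0
        have : g x x = 0 := by rw [h0]; simp [hv]
        exact ⟨this.le, fun _ => ⟨_, h0⟩⟩
      · have := hneg _ h0 (by simp [hpv.ne']) (by simp [hx, hv])
        rw [apply_sub_smul_self hg, hx, hv] at this
        exact ⟨by linarith, fun h => by linarith⟩
    refine isLorentzForm_of_neg_on_orthogonal hy (fun x hx hx0 => ?_) hg
    obtain ⟨hle, heq⟩ := hker (x - (g v x / g v y) • y) (by simp [hvy])
    rw [apply_sub_smul_self hg, hx] at hle heq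
    have hsq := mul_nonneg (sq_nonneg (g v x / g v y)) hy.le
    refine lt_of_le_of_ne (by linarith) fun h => ?_
    have hs : (g v x / g v y) ^ 2 * g y y = 0 := by linarith
    obtain ⟨c, hc⟩ := heq (by linarith)
    have hs0 : g v x / g v y = 0 := by simpa [hy.ne'] using hs
    rw [hs0, zero_smul, sub_zero] at hc
    rw [hc, map_smul, smul_eq_mul, hg y v, mul_eq_zero, or_iff_left hvy] at hx
    exact hx0 (by rw [hc, hx, zero_smul])

end LorentzForm

theorem LinearMap.eq_of_ker_eq_of_apply_eq {K E : Type*} [Field K] [AddCommGroup E] [Module K E]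
    {φ ψ : E →ₗ[K] K} {v : E} (hker : {w | φ w = 0} = {w | ψ w = 0}) (h : φ v = ψ v)
    (hv : φ v ≠ 0) : φ = ψ := by
  ext w
  have : w - (φ w / φ v) • v ∈ {w | ψ w = 0} := by
    rw [← hker]
    simp [hv]
  simp only [mem_ofPred_eq, map_sub, map_smul, smul_eq_mul, ← h] at this
  rw [div_mul_cancel₀ _ hv, sub_eq_zero] at this
  exact this.symm

/-- The fundamental tensor as a bilinear form. -/
def fundForm (f : V → ℝ) (v : V) : LinearMap.BilinForm ℝ V :=
  LinearMap.mk₂ ℝ (fundTensor f v) (by simp [fundTensor, mul_add])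
    (by simp [fundTensor, mul_left_comm]) (by simp [fundTensor, mul_add])
    (by simp [fundTensor, mul_left_comm])

@[simp]
theorem fundForm_apply (f : V → ℝ) (v u w : V) : fundForm f v u w = fundTensor f v u w := rfl

theorem fundTensor_comm {f : V → ℝ} {v : V} (hf : ContDiffAt ℝ 2 f v) (u w : V) :
    fundTensor f v u w = fundTensor f v w u := by
  have := hf.isSymmSndFDerivAt (by simp)
  simp only [fundTensor]
  rw [this.eq]

/-- Euler's relation for the second derivative of a positively 2-homogeneous function. -/
theorem fundTensor_self {f : V → ℝ} {v : V} (hf : ContDiffAt ℝ 2 f v)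
    (hom : ∀ c : ℝ, 0 < c → f (c • v) = c ^ 2 * f v) : fundTensor f v v v = f v := by
  have hline (t : ℝ) : HasDerivAt (fun t : ℝ => t • v) v t := by
    simpa using (hasDerivAt_id t).smul_const v
  have hcont : Filter.Tendsto (fun t : ℝ => t • v) (nhds 1) (nhds v) := by
    simpa using (hline 1).continuousAt.tendsto
  have hdiff : ∀ᶠ x in nhds v, DifferentiableAt ℝ f x :=
    (hf.eventually (by simp)).mono fun x hx => hx.differentiableAt (by simp)
  have hfirst : (fun t : ℝ => fderiv ℝ f (t • v) v) =ᶠ[nhds 1] fun t => 2 * t * f v := by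
    filter_upwards [hcont.eventually hdiff, lt_mem_nhds (zero_lt_one (α := ℝ))] with t ht ht0
    refine (ht.hasFDerivAt.comp_hasDerivAt t (hline t)).unique ?_
    have : HasDerivAt (fun t : ℝ => t ^ 2 * f v) (2 * t * f v) t := by
      simpa using (hasDerivAt_pow 2 t).mul_const (f v)
    refine this.congr_of_eventuallyEq ?_
    filter_upwards [lt_mem_nhds ht0] with s hs using hom s hs
  have hd2 : HasFDerivAt (fderiv ℝ f) (fderiv ℝ (fderiv ℝ f) v) ((1 : ℝ) • v) := by
    rw [one_smul]
    exact ((hf.fderiv_right (m := 1) (by norm_num)).differentiableAt (by simp)).hasFDerivAt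
  have h1 : HasDerivAt (fun t : ℝ => fderiv ℝ f (t • v) v) (fderiv ℝ (fderiv ℝ f) v v v) 1 := by
    have h := hd2.comp_hasDerivAt (f := fun t : ℝ => t • v) (1 : ℝ) (hline 1)
    simpa using h.clm_apply (hasDerivAt_const (1 : ℝ) v)
  have h2 : HasDerivAt (fun t : ℝ => 2 * t * f v) (2 * f v) 1 := by
    simpa using ((hasDerivAt_id (1 : ℝ)).const_mul 2).mul_const (f v)
  rw [fundTensor, h1.unique (h2.congr_of_eventuallyEq hfirst)]
  ring

theorem fundTensor_quadratic_sub [FiniteDimensional ℝ V] {p : LinearMap.BilinForm ℝ V}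
    (hp : ∀ u w, p u w = p w u) {f : V → ℝ} {v : V} (hf : ContDiffAt ℝ 2 f v) (u w : V) :
    fundTensor (fun x => p x x - f x) v u w = p u w - fundTensor f v u w := by
  let B : V →L[ℝ] V →L[ℝ] ℝ := LinearMap.toContinuousBilinearMap p
  have hQ (x : V) : HasFDerivAt (fun x => p x x) ((2 : ℝ) • B x) x := by
    have := B.hasFDerivAt_of_bilinear (hasFDerivAt_id x) (hasFDerivAt_id x)
    refine this.congr_fderiv ?_
    ext y
    simp [B, hp y x, two_mul]
  have hfirst : fderiv ℝ (fun x => p x x - f x) =ᶠ[nhds v] fun x => (2 : ℝ) • B x - fderiv ℝ f x :=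
    (hf.eventually (by simp)).mono fun x hx =>
      ((hQ x).sub (hx.differentiableAt (by simp)).hasFDerivAt).fderiv
  have hd2 := ((hf.fderiv_right (m := 1) (by norm_num)).differentiableAt (by simp)).hasFDerivAt
  have h : HasFDerivAt (fun x => (2 : ℝ) • B x - fderiv ℝ f x)
      ((2 : ℝ) • B - fderiv ℝ (fderiv ℝ f) v) v := (B.hasFDerivAt.fun_const_smul 2).fun_sub hd2
  rw [fundTensor, hfirst.fderiv_eq, h.fderiv, fundTensor]
  simp [B]
  ring

/-- characterization of when `L = g_R - F̂²` has Lorentzian fundamental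
tensor on the closed cone domain. -/
theorem stmt_2 [FiniteDimensional ℝ V] (hn : 2 ≤ finrank ℝ V)
    (A : Set V) (hA : A.Nonempty) (hA0 : (0 : V) ∉ A) (hAop : IsOpen A)
    (hAconn : IsConnected A) (hAconic : Conic A)
    (gR : V →ₗ[ℝ] V →ₗ[ℝ] ℝ) (hsym : ∀ u w : V, gR u w = gR w u)
    (hposdef : ∀ v : V, v ≠ 0 → 0 < gR v v)
    (F : V → ℝ) (Astar : Set V) (hF : IsConicMinkowski F Astar)
    (hAsub : closure A \ {0} ⊆ Astar)
    (L : V → ℝ) (hLdef : ∀ v : V, L v = gR v v - F v ^ 2)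
    (hLpos : ∀ v ∈ A, 0 < L v)
    (hLzero : ∀ v ∈ (closure A \ {0}) \ A, L v = 0) :
    (∀ v ∈ closure A \ {0}, IsLorentzForm (fundTensor L v)) ↔
      ((∀ v ∈ A, ∀ w : V, w ≠ 0 → gR v w = 0 →
          gR w w - fundTensor (fun x => F x ^ 2) v w w
            - (fundTensor (fun x => F x ^ 2) v v w) ^ 2 / L v < 0) ∧
       (∀ v ∈ (closure A \ {0}) \ A,
          (∀ w : V, w ≠ 0 → gR v w = 0 → fundTensor (fun x => F x ^ 2) v v w = 0 →
            gR w w - fundTensor (fun x => F x ^ 2) v w w < 0) ∧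
          {w : V | gR v w = 0} ≠ {w : V | fundTensor (fun x => F x ^ 2) v v w = 0})) := by
  set f : V → ℝ := fun x => F x ^ 2 with hf
  have hsmooth {v : V} (hv : v ∈ closure A \ {0}) : ContDiffAt ℝ 2 f v :=
    ((hF.smooth.contDiffAt (hF.isOpen.mem_nhds (hAsub hv))).pow 2).of_le 
      (WithTop.coe_le_coe.2 le_top)
  have hself {v : V} (hv : v ∈ closure A \ {0}) : fundTensor f v v v = f v :=
    fundTensor_self (hsmooth hv) fun c hc => by
      simp only [hf, hF.hom v (hAsub hv) c hc, mul_pow]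
  have hform {v : V} (hv : v ∈ closure A \ {0}) :
      fundTensor L v = fun u w => (gR - fundForm f v) u w := by
    obtain rfl : L = fun x => gR x x - f x := funext hLdef
    ext u w
    exact fundTensor_quadratic_sub hsym (hsmooth hv) u w
  have hgsym {v : V} (hv : v ∈ closure A \ {0}) (u w : V) :
      (gR - fundForm f v) u w = (gR - fundForm f v) w u := by
    simp [hsym u w, fundTensor_comm (hsmooth hv) u w]
  have hgself {v : V} (hv : v ∈ closure A \ {0}) : (gR - fundForm f v) v v = L v := by
    rw [LinearMap.sub_apply, LinearMap.sub_apply, fundForm_apply, hself hv, hLdef]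
  have hAcl {v : V} (hv : v ∈ A) : v ∈ closure A \ {0} :=
    ⟨subset_closure hv, by rintro rfl; exact hA0 hv⟩
  have htime {v : V} (hv : v ∈ A) : IsLorentzForm (fundTensor L v) ↔
      ∀ w : V, w ≠ 0 → gR v w = 0 →
        gR w w - fundTensor f v w w - (fundTensor f v v w) ^ 2 / L v < 0 := by
    rw [hform (hAcl hv), isLorentzForm_iff_of_pos (hgsym (hAcl hv)) hposdef
      (by rw [hgself (hAcl hv)]; exact hLpos v hv), hgself (hAcl hv)]
    refine forall_congr' fun w => imp_congr_right fun _ => imp_congr_right fun hw => ?_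
    simp [hw]
  have hlight {v : V} (hv : v ∈ (closure A \ {0}) \ A) : IsLorentzForm (fundTensor L v) ↔
      (∀ w : V, w ≠ 0 → gR v w = 0 → fundTensor f v v w = 0 →
        gR w w - fundTensor f v w w < 0) ∧
      {w : V | gR v w = 0} ≠ {w : V | fundTensor f v v w = 0} := by
    have hg0 : (gR - fundForm f v) v v = 0 := by rw [hgself hv.1, hLzero v hv]
    rw [hform hv.1, isLorentzForm_iff_of_eq_zero (hgsym hv.1) hposdef hv.1.2 hg0]
    refine and_congr ?_ (not_congr ⟨fun h => ?_, fun h => ?_⟩)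
    · refine forall_congr' fun w => imp_congr_right fun _ => imp_congr_right fun hw => ?_
      simp [hw]
    · ext w
      have := LinearMap.congr_fun h w
      simp only [LinearMap.sub_apply, fundForm_apply, LinearMap.zero_apply, sub_eq_zero] at this
      simp [this]
    · rw [LinearMap.sub_apply, sub_eq_zero]
      exact LinearMap.eq_of_ker_eq_of_apply_eq (v := v) h (sub_eq_zero.1 hg0)
        (hposdef v hv.1.2).ne'
  constructor
  · exact fun h => ⟨fun v hv => (htime hv).1 (h v (hAcl hv)),
      fun v hv => (hlight hv).1 (h v hv.1)⟩
  · rintro ⟨h1, h2⟩ v hv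
    by_cases hvA : v ∈ A
    · exact (htime hvA).2 (h1 v hvA)
    · exact (hlight ⟨hv, hvA⟩).2 (h2 v ⟨hv, hvA⟩)
end
end

section
/- Let L be a properly Lorentz-Minkowski norm on V with cone domain A. Then there exist a positive definite symmetric bilinear form g_R on V and a conic Minkowski norm F̂ defined on some open conic set A* ⊆ V ∖ {0} with Ā ⊆ A*, such that L(v) = g_R(v,v) − F̂(v)² for every v ∈ Ā. -/
open Set Module

noncomputable section

variable {V : Type*} [NormedAddCommGroup V] [NormedSpace ℝ V]

/-- A function satisfying `f (c • v) = k • f v` on an open set has derivative satisfying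
`f' (c • v) = (c⁻¹ * k) • f' v` there. -/
theorem fderiv_smul_of_homogeneous {W : Type*} [NormedAddCommGroup W] [NormedSpace ℝ W]
    {f : V → W} {s : Set V} (hs : IsOpen s) {c k : ℝ} (hc : c ≠ 0)
    (hf : ∀ v ∈ s, f (c • v) = k • f v) {v : V} (hv : v ∈ s) :
    fderiv ℝ f (c • v) = (c⁻¹ * k) • fderiv ℝ f v := by
  have h : (fun x => f (c • x)) =ᶠ[nhds v] fun x => k • f x :=
    Filter.eventually_of_mem (hs.mem_nhds hv) hf
  have h1 : fderiv ℝ (fun x => f (c • x)) v = fderiv ℝ (k • f) v := h.fderiv_eq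
  rw [fderiv_comp_smul, fderiv_const_smul_field] at h1
  rw [mul_smul, ← Pi.smul_apply k, ← h1, inv_smul_smul₀ hc]

/-- The second derivative of a positively 2-homogeneous function is invariant under scaling. -/
theorem PosHom2.fderiv_fderiv_smul {L : V → ℝ} {s : Set V} (hs : IsOpen s)
    (hL : PosHom2 L s) {c : ℝ} (hc : 0 < c) {v : V} (hv : v ∈ s) :
    fderiv ℝ (fderiv ℝ L) (c • v) = fderiv ℝ (fderiv ℝ L) v := by
  have h1 : ∀ w ∈ s, fderiv ℝ L (c • w) = c • fderiv ℝ L w := fun w hw => by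
    rw [fderiv_smul_of_homogeneous (k := c ^ 2) hs hc.ne' (fun x hx => hL x hx c hc) hw]
    congr 1
    field_simp
  rw [fderiv_smul_of_homogeneous hs hc.ne' h1 hv, inv_mul_cancel₀ hc.ne', one_smul]

/-- The closure of a conic set is conic. -/
theorem Conic.closure {s : Set V} (hs : Conic s) : Conic (closure s) := fun _ hv c hc =>
  map_mem_closure (continuous_const_smul c) hv fun w hw => hs w hw c hc

/-- The fundamental tensor of a quadratic form minus `L` is the bilinear form minus that of `L`. -/
theorem fundTensor_bilin_sub {B : V →L[ℝ] V →L[ℝ] ℝ} (hB : ∀ u w, B u w = B w u)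
    {L f : V → ℝ} {s : Set V} (hs : IsOpen s) (hL : ContDiffOn ℝ (⊤ : ℕ∞) L s)
    (hf : ∀ v ∈ s, f v = B v v - L v) {v : V} (hv : v ∈ s) (u w : V) :
    fundTensor f v u w = B u w - fundTensor L v u w := by
  have hd : ∀ x ∈ s, fderiv ℝ f x = (2 : ℝ) • B x - fderiv ℝ L x := fun x hx => by
    have h : f =ᶠ[nhds x] fun y => B y y - L y := Filter.eventually_of_mem (hs.mem_nhds hx) hf
    have hLx : HasFDerivAt L (fderiv ℝ L x) x :=
      ((hL.contDiffAt (hs.mem_nhds hx)).differentiableAt (by simp)).hasFDerivAt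
    have hq := (B.hasFDerivAt (x := x)).clm_apply (hasFDerivAt_id x)
    rw [h.fderiv_eq]
    refine ((hq.sub hLx).congr_fderiv ?_).fderiv
    ext y
    simp [hB y x, two_mul]
  have h : fderiv ℝ f =ᶠ[nhds v] fun x => (2 : ℝ) • B x - fderiv ℝ L x :=
    Filter.eventually_of_mem (hs.mem_nhds hv) hd
  have hL2 : HasFDerivAt (fderiv ℝ L) (fderiv ℝ (fderiv ℝ L) v) v :=
    (((hL.contDiffAt (hs.mem_nhds hv)).fderiv_right (m := 1)
      (by norm_cast)).differentiableAt (by simp)).hasFDerivAt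
  have h2 := ((B.hasFDerivAt (x := v)).const_smul (2 : ℝ)).sub hL2
  have h3 : fderiv ℝ (fderiv ℝ f) v = (2 : ℝ) • B - fderiv ℝ (fderiv ℝ L) v := by
    rw [h.fderiv_eq]
    exact h2.fderiv
  simp only [fundTensor, h3, sub_apply, smul_apply,
    smul_eq_mul]
  ring

/-- A finite-dimensional normed space carries symmetric bilinear forms that dominate any
prescribed multiple of the squared norm. -/
theorem exists_symm_bilin_ge (V : Type*) [NormedAddCommGroup V] [NormedSpace ℝ V]
    [FiniteDimensional ℝ V] {M : ℝ} (hM : 0 ≤ M) :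
    ∃ B : V →L[ℝ] V →L[ℝ] ℝ, (∀ u w, B u w = B w u) ∧ ∀ u, M * ‖u‖ ^ 2 ≤ B u u := by
  let e : V ≃L[ℝ] EuclideanSpace ℝ (Fin (finrank ℝ V)) := toEuclidean
  let K : ℝ := ‖(e.symm : EuclideanSpace ℝ (Fin (finrank ℝ V)) →L[ℝ] V)‖
  refine ⟨(M * K ^ 2) • (innerSL ℝ).bilinearComp e.toContinuousLinearMap e.toContinuousLinearMap,
    fun u w => ?_, fun u => ?_⟩
  · simp [real_inner_comm]
  · have h : ‖u‖ ≤ K * ‖e u‖ := by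
      simpa using (e.symm : EuclideanSpace ℝ (Fin (finrank ℝ V)) →L[ℝ] V).le_opNorm (e u)
    have h2 : ‖u‖ ^ 2 ≤ (K * ‖e u‖) ^ 2 := by gcongr
    calc M * ‖u‖ ^ 2 ≤ M * (K * ‖e u‖) ^ 2 := by gcongr
      _ = _ := by simp; ring

/-- any properly Lorentz-Minkowski norm is a difference of a Riemannian
(positive definite bilinear) form and the square of a conic Minkowski norm. -/
theorem stmt_3 [FiniteDimensional ℝ V] (hn : 2 ≤ finrank ℝ V)
    (L : V → ℝ) (A : Set V) (hL : IsProperLMNorm L A) :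
    ∃ (gR : V →ₗ[ℝ] V →ₗ[ℝ] ℝ) (F : V → ℝ) (Astar : Set V),
      (∀ u w : V, gR u w = gR w u) ∧
      (∀ v : V, v ≠ 0 → 0 < gR v v) ∧
      IsConicMinkowski F Astar ∧
      closure A \ {0} ⊆ Astar ∧
      (∀ v ∈ closure A \ {0}, L v = gR v v - F v ^ 2) := by
  obtain ⟨U, hUo, hUc, hU0, hAU, hsm, hhom⟩ := hL.smooth_ext
  have hS : IsCompact (closure A ∩ Metric.sphere 0 1) :=
    (isCompact_sphere 0 1).inter_left isClosed_closure
  have hSU : closure A ∩ Metric.sphere 0 1 ⊆ U := fun v hv =>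
    hAU ⟨hv.1, fun h => by simp [mem_singleton_iff.1 h] at hv⟩
  have hD2 : ContinuousOn (fun v => ‖fderiv ℝ (fderiv ℝ L) v‖) U :=
    ((hsm.fderiv_of_isOpen (m := 1) hUo (by norm_cast)).continuousOn_fderiv_of_isOpen
      hUo le_rfl).norm
  obtain ⟨M₁, hM₁⟩ := hS.exists_bound_of_continuousOn (hsm.continuousOn.mono hSU)
  obtain ⟨M₂, hM₂⟩ := hS.exists_bound_of_continuousOn (hD2.mono hSU)
  obtain ⟨M, hM0, hMM₁, hMM₂⟩ : ∃ M : ℝ, 0 < M ∧ M₁ < M ∧ M₂ < M :=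
    ⟨max 0 (max M₁ M₂) + 1, by positivity, by grind, by grind⟩
  obtain ⟨B, hBs, hB⟩ := exists_symm_bilin_ge V hM0.le
  let s : Set V := (U ∩ (fun v => M * ‖v‖ ^ 2 - L v) ⁻¹' Ioi 0) ∩
    (U ∩ (fun v => ‖fderiv ℝ (fderiv ℝ L) v‖) ⁻¹' Iio M)
  have hsU : s ⊆ U := fun v hv => hv.1.1
  have hso : IsOpen s :=
    (ContinuousOn.isOpen_inter_preimage
      ((by fun_prop : Continuous fun v : V => M * ‖v‖ ^ 2).continuousOn.sub hsm.continuousOn)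
      hUo isOpen_Ioi).inter (hD2.isOpen_inter_preimage hUo isOpen_Iio)
  have hsc : Conic s := by
    rintro v ⟨⟨hv, hv1⟩, -, hv2⟩ c hc
    refine ⟨⟨hUc v hv c hc, ?_⟩, hUc v hv c hc, ?_⟩
    · have : M * ‖c • v‖ ^ 2 - L (c • v) = c ^ 2 * (M * ‖v‖ ^ 2 - L v) := by
        rw [hhom v hv c hc, norm_smul, mul_pow, Real.norm_eq_abs, sq_abs]
        ring
      simp only [mem_preimage, mem_Ioi, this]
      exact mul_pos (by positivity) hv1
    · simpa only [mem_preimage, hhom.fderiv_fderiv_smul hUo hc hv] using hv2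
  have hSs : closure A ∩ Metric.sphere 0 1 ⊆ s := fun v hv => by
    have hn1 : ‖v‖ = 1 := by simpa using hv.2
    refine ⟨⟨hSU hv, ?_⟩, hSU hv, (le_abs_self _).trans_lt ((hM₂ v hv).trans_lt hMM₂)⟩
    have := (le_abs_self _).trans_lt ((hM₁ v hv).trans_lt hMM₁)
    simpa [hn1] using this
  have hAs : closure A \ {0} ⊆ s := fun v ⟨hv, hv0⟩ => by
    have hp : 0 < ‖v‖ := norm_pos_iff.2 hv0
    have hmem : ‖v‖⁻¹ • v ∈ s := hSs
      ⟨hL.conic.closure v hv _ (inv_pos.2 hp), by simp [norm_smul, hp.ne']⟩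
    simpa [smul_smul, hp.ne'] using hsc _ hmem _ hp
  have hpos : ∀ v ∈ s, 0 < B v v - L v := fun v hv => by
    have : 0 < M * ‖v‖ ^ 2 - L v := hv.1.2
    linarith [hB v]
  have hsq : ∀ v ∈ s, √(B v v - L v) ^ 2 = B v v - L v := fun v hv => Real.sq_sqrt (hpos v hv).le
  have hBpos : ∀ v : V, v ≠ 0 → 0 < B v v := fun v hv =>
    (mul_pos hM0 (pow_pos (norm_pos_iff.2 hv) 2)).trans_le (hB v)
  refine ⟨B.toLinearMap₁₂, fun v => √(B v v - L v), s, hBs, hBpos,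
    ⟨hso, hsc, fun h => hU0 (hsU h), fun v hv => Real.sqrt_pos.2 (hpos v hv), ?_, ?_, ?_⟩,
    hAs, fun v hv => ?_⟩
  · have hq : ContDiff ℝ (⊤ : ℕ∞) fun v => B v v := B.contDiff.clm_apply contDiff_id
    exact (hq.contDiffOn.sub (hsm.mono hsU)).sqrt fun v hv => (hpos v hv).ne'
  · intro v hv c hc
    have : B (c • v) (c • v) - L (c • v) = c ^ 2 * (B v v - L v) := by
      rw [hhom v (hsU hv) c hc]
      simp
      ring
    simp only [this, Real.sqrt_mul (sq_nonneg c), Real.sqrt_sq hc.le]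
  · intro v hv u hu
    rw [fundTensor_bilin_sub hBs hso (hsm.mono hsU) hsq hv, fundTensor]
    have h1 : ‖fderiv ℝ (fderiv ℝ L) v‖ < M := hv.2.2
    have h2 := (le_abs_self _).trans ((fderiv ℝ (fderiv ℝ L) v).le_opNorm₂ u u)
    have h3 : 0 < ‖u‖ := norm_pos_iff.2 hu
    nlinarith [hB u, mul_pos h3 h3, mul_lt_mul_of_pos_right h1 (mul_pos h3 h3)]
  · simp [hsq v (hAs hv)]
end
end

section
/- Let E be a finite-dimensional real inner product space and t0 : E → ℝ a continuous convex function that is C^∞ on E ∖ {0}, whose second derivative D²t0(x) is positive definite for every x ≠ 0, and such that there exist ρ > 0 and δ > 0 with D²t0(x)(u,u) ≥ δ·‖u‖² for all x with 0 < ‖x‖ < ρ and all u ∈ E. Then for every r > 0 and every ε > 0 there exists a C^∞ function t̃0 : E → ℝ whose second derivative D²t̃0(x) is positive definite at every x ∈ E, such that t̃0(x) = t0(x) whenever ‖x‖ ≥ r/2, and |t̃0(x) − t0(x)| < ε for all x ∈ E. -/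
open Set

noncomputable section

variable {E : Type*} [NormedAddCommGroup E] [InnerProductSpace ℝ E]

/-- The second Fréchet derivative of `f` at `x`, as a bilinear expression. -/
def secondDeriv (f : E → ℝ) (x u w : E) : ℝ :=
  fderiv ℝ (fderiv ℝ f) x u w

open Filter Topology

/-- A smooth convex function on the line that is the identity on `[0, ∞)` and constant on
`(-∞, -η]`, with slopes in `[0, 1]`. -/
lemma exists_smooth_positivePart {η : ℝ} (hη : 0 < η) :
    ∃ g : ℝ → ℝ, ContDiff ℝ (⊤ : ℕ∞) g ∧ Monotone (deriv g) ∧ (∀ s, 0 ≤ deriv g s) ∧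
      (∀ s, deriv g s ≤ 1) ∧ (∀ s, 0 ≤ s → g s = s) ∧ (∃ κ, ∀ s, s ≤ -η → g s = κ) := by
  set θ : ℝ → ℝ := fun s => Real.smoothTransition (1 + s / η) with hθ
  have hθs : ContDiff ℝ (⊤ : ℕ∞) θ := Real.smoothTransition.contDiff.comp (by fun_prop)
  have hθc : Continuous θ := hθs.continuous
  have hd : ∀ s, HasDerivAt (fun s => ∫ t in (0 : ℝ)..s, θ t) (θ s) s := fun s =>
    intervalIntegral.integral_hasDerivAt_right (hθc.intervalIntegrable _ _)
      hθc.aestronglyMeasurable.stronglyMeasurableAtFilter hθc.continuousAt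
  have hderiv : deriv (fun s => ∫ t in (0 : ℝ)..s, θ t) = θ := funext fun s => (hd s).deriv
  refine ⟨fun s => ∫ t in (0 : ℝ)..s, θ t, ?_, ?_, ?_, ?_, ?_, ∫ t in (0 : ℝ)..(-η), θ t, ?_⟩
  · exact contDiff_infty_iff_deriv.2 ⟨fun s => (hd s).differentiableAt, by rwa [hderiv]⟩
  · rw [hderiv]
    intro a b hab
    exact Real.smoothTransition.monotone (by gcongr)
  · rw [hderiv]
    exact fun s => Real.smoothTransition.nonneg _
  · rw [hderiv]
    exact fun s => Real.smoothTransition.le_one _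
  · intro s hs
    have : ∫ t in (0 : ℝ)..s, θ t = ∫ t in (0 : ℝ)..s, (1 : ℝ) := by
      refine intervalIntegral.integral_congr fun t ht => ?_
      rw [Set.uIcc_of_le hs] at ht
      exact Real.smoothTransition.one_of_one_le (by have := div_nonneg ht.1 hη.le; linarith)
    simpa using this
  · intro s hs
    have : ∫ t in (-η)..s, θ t = ∫ t in (-η)..s, (0 : ℝ) := by
      refine intervalIntegral.integral_congr fun t ht => ?_
      rw [Set.uIcc_of_ge hs] at ht
      refine Real.smoothTransition.zero_of_nonpos ?_
      have : t / η ≤ -1 := by rw [div_le_iff₀ hη]; linarith [ht.2]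
      linarith
    simp only
    rw [← intervalIntegral.integral_add_adjacent_intervals (hθc.intervalIntegrable 0 (-η))
      (hθc.intervalIntegrable (-η) s), this]
    simp

lemma secondDeriv_congr {f h : E → ℝ} {x : E} (hfh : f =ᶠ[𝓝 x] h) (u w : E) :
    secondDeriv f x u w = secondDeriv h x u w := by
  simp only [secondDeriv, hfh.fderiv.fderiv_eq]

lemma secondDeriv_quadratic (l : E →L[ℝ] ℝ) (c a : ℝ) (x u : E) :
    secondDeriv (fun y => l y + c + a * ‖y‖ ^ 2) x u u = 2 * a * ‖u‖ ^ 2 := by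
  have h1 : fderiv ℝ (fun y : E => l y + c + a * ‖y‖ ^ 2) =
      fun y => l + (2 * a) • innerSL ℝ y := by
    funext y
    have := ((l.hasFDerivAt (x := y)).add_const c).add
      ((hasStrictFDerivAt_norm_sq y).hasFDerivAt.const_mul a)
    refine (HasFDerivAt.fderiv this).trans ?_
    ext v
    simp
    ring
  have h2 : HasFDerivAt (fun y : E => l + (2 * a) • innerSL ℝ y)
      ((2 * a) • (innerSL ℝ : E →L[ℝ] E →L[ℝ] ℝ)) x :=
    (((innerSL ℝ : E →L[ℝ] E →L[ℝ] ℝ).hasFDerivAt (x := x)).const_smul (2 * a)).const_add l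
  rw [secondDeriv, h1, h2.fderiv]
  exact congrArg (2 * a * ·) (real_inner_self_eq_norm_sq u)

/-- Gluing two functions by a transition function with slopes in `[0, 1]` interpolates the
Hessians up to a rank one term. -/
lemma secondDeriv_add_comp_sub
    {f q : E → ℝ} {g : ℝ → ℝ} {x : E} (hf : ContDiffAt ℝ 2 f x) (hq : ContDiffAt ℝ 2 q x)
    (hg : ContDiff ℝ 2 g) (u : E) :
    secondDeriv (fun y => q y + g (f y - q y)) x u u =
      (1 - deriv g (f x - q x)) * secondDeriv q x u u
        + deriv g (f x - q x) * secondDeriv f x u u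
        + deriv (deriv g) (f x - q x) * (fderiv ℝ f x u - fderiv ℝ q x u) ^ 2 := by
  have hg1 : Differentiable ℝ g := hg.differentiable (by norm_num)
  have hg2 : Differentiable ℝ (deriv g) :=
    (contDiff_succ_iff_deriv.1 (show ContDiff ℝ (1 + 1) g by
      simpa [one_add_one_eq_two] using hg)).2.2.differentiable (by norm_num)
  have hev : ∀ {h : E → ℝ}, ContDiffAt ℝ 2 h x → ∀ᶠ y in 𝓝 x, DifferentiableAt ℝ h y :=
    fun hh => (hh.eventually (by simp)).mono fun y hy => hy.differentiableAt (by norm_num)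
  have hdd : ∀ {h : E → ℝ}, ContDiffAt ℝ 2 h x → DifferentiableAt ℝ (fderiv ℝ h) x := fun hh =>
    (hh.fderiv_right (m := 1) (by norm_num [one_add_one_eq_two])).differentiableAt (by norm_num)
  have h1 : fderiv ℝ (fun y => q y + g (f y - q y)) =ᶠ[𝓝 x]
      fun y => fderiv ℝ q y + deriv g (f y - q y) • (fderiv ℝ f y - fderiv ℝ q y) := by
    filter_upwards [hev hf, hev hq] with y hfy hqy
    exact (hqy.hasFDerivAt.add ((hg1 _).hasDerivAt.comp_hasFDerivAt y
      (hfy.hasFDerivAt.sub hqy.hasFDerivAt))).fderiv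
  have hfx := (hev hf).self_of_nhds.hasFDerivAt
  have hqx := (hev hq).self_of_nhds.hasFDerivAt
  have h2 := (hdd hq).hasFDerivAt.add
    (((hg2 (f x - q x)).hasDerivAt.comp_hasFDerivAt x (hfx.sub hqx)).smul
      ((hdd hf).hasFDerivAt.sub (hdd hq).hasFDerivAt))
  have h3 := (h2.congr_of_eventuallyEq h1).fderiv
  simp only [secondDeriv, h3]
  simp
  ring

/-- A lower bound `δ` on the Hessian on a punctured ball forces quadratic growth above any
lower bound that is nearly attained at the origin. -/
lemma quadratic_growth_of_secondDeriv
    {f : E → ℝ} {ρ δ : ℝ} (hcont : Continuous f) (hsmooth : ContDiffOn ℝ 2 f {0}ᶜ)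
    (hbound : ∀ x : E, 0 < ‖x‖ → ‖x‖ < ρ → ∀ u : E, δ * ‖u‖ ^ 2 ≤ secondDeriv f x u u)
    (l : E →L[ℝ] ℝ) (c : ℝ) (hl : ∀ x, l x + c ≤ f x) {x : E} (hx : ‖x‖ < ρ) :
    l x + c + δ / 4 * ‖x‖ ^ 2 - (f 0 - c) ≤ f x := by
  rcases eq_or_ne x 0 with rfl | hx0
  · have := hl 0
    simp at this ⊢
    linarith
  have hxpos : 0 < ‖x‖ := norm_pos_iff.2 hx0
  set K := δ * ‖x‖ ^ 2 with hK
  set ψ : ℝ → ℝ := fun τ => f (τ • x) - K / 2 * τ ^ 2 with hψ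
  have hat : ∀ y : E, y ≠ 0 → ContDiffAt ℝ 2 f y := fun y hy =>
    hsmooth.contDiffAt (isOpen_compl_singleton.mem_nhds hy)
  have hline : ∀ τ : ℝ, HasDerivAt (fun τ : ℝ => τ • x) x τ := fun τ => by
    simpa using (hasDerivAt_id τ).smul_const x
  have hd1 : ∀ τ : ℝ, 0 < τ → HasDerivAt ψ (fderiv ℝ f (τ • x) x - K * τ) τ := by
    intro τ hτ
    have h1 := ((hat (τ • x) (smul_ne_zero hτ.ne' hx0)).differentiableAt
      (by norm_num)).hasFDerivAt.comp_hasDerivAt τ (hline τ)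
    refine (h1.sub ((hasDerivAt_pow 2 τ).const_mul (K / 2))).congr_deriv ?_
    norm_num
    ring
  have hd2 : ∀ τ : ℝ, 0 < τ →
      HasDerivAt (deriv ψ) (secondDeriv f (τ • x) x x - K) τ := by
    intro τ hτ
    have h1 : DifferentiableAt ℝ (fderiv ℝ f) (τ • x) :=
      ((hat (τ • x) (smul_ne_zero hτ.ne' hx0)).fderiv_right (m := 1)
        (by norm_num [one_add_one_eq_two])).differentiableAt (by norm_num)
    have h2 : HasDerivAt (fun τ : ℝ => fderiv ℝ f (τ • x)) (fderiv ℝ (fderiv ℝ f) (τ • x) x) τ :=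
      h1.hasFDerivAt.comp_hasDerivAt τ (hline τ)
    have h3 : HasDerivAt (fun τ : ℝ => fderiv ℝ f (τ • x) x - K * τ)
        (secondDeriv f (τ • x) x x - K) τ := by
      have h := h2.clm_apply (hasDerivAt_const τ x)
      rw [map_zero, add_zero] at h
      exact (h.sub ((hasDerivAt_id' τ).const_mul K)).congr_deriv (by simp [secondDeriv])
    have h4 : deriv ψ =ᶠ[𝓝 τ] fun τ => fderiv ℝ f (τ • x) x - K * τ := by
      filter_upwards [lt_mem_nhds hτ] with σ hσ using (hd1 σ hσ).deriv
    exact h3.congr_of_eventuallyEq h4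
  have hconv : ConvexOn ℝ (Icc 0 1) ψ := by
    refine convexOn_of_deriv2_nonneg (convex_Icc 0 1) (by fun_prop) ?_ ?_ ?_ <;>
      rw [interior_Icc]
    · exact fun τ hτ => (hd1 τ hτ.1).differentiableAt.differentiableWithinAt
    · exact fun τ hτ => (hd2 τ hτ.1).differentiableAt.differentiableWithinAt
    · intro τ hτ
      have hn : ‖τ • x‖ = τ * ‖x‖ := by rw [norm_smul, Real.norm_of_nonneg hτ.1.le]
      have := hbound (τ • x) (hn ▸ mul_pos hτ.1 hxpos)
        (by rw [hn]; nlinarith [hτ.2]) x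
      simp only [Function.iterate_succ, Function.iterate_zero, Function.comp_apply, id]
      rw [(hd2 τ hτ.1).deriv]
      linarith
  have hmid := hconv.2 (left_mem_Icc.2 zero_le_one) (right_mem_Icc.2 zero_le_one)
    (show (0 : ℝ) ≤ 1 / 2 by norm_num) (show (0 : ℝ) ≤ 1 / 2 by norm_num) (by norm_num)
  have hhalf := hl ((1 / 2 : ℝ) • x)
  simp [hψ] at hmid hhalf
  rw [hK] at hmid
  nlinarith

/-- a convex function, smooth and strongly convex away from the origin with
a uniform lower Hessian bound near the origin, can be approximated by a globally smooth
strongly convex function agreeing with it outside a small disk. -/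
theorem stmt_6 [FiniteDimensional ℝ E]
    (t₀ : E → ℝ) (hconv : ConvexOn ℝ Set.univ t₀) (hcont : Continuous t₀)
    (hsmooth : ContDiffOn ℝ (⊤ : ℕ∞) t₀ {0}ᶜ)
    (hposdef : ∀ x : E, x ≠ 0 → ∀ u : E, u ≠ 0 → 0 < secondDeriv t₀ x u u)
    (ρ δ : ℝ) (hρ : 0 < ρ) (hδ : 0 < δ)
    (hbound : ∀ x : E, 0 < ‖x‖ → ‖x‖ < ρ → ∀ u : E,
      δ * ‖u‖ ^ 2 ≤ secondDeriv t₀ x u u) :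
    ∀ r : ℝ, 0 < r → ∀ ε : ℝ, 0 < ε →
      ∃ t₁ : E → ℝ, ContDiff ℝ (⊤ : ℕ∞) t₁ ∧
        (∀ x : E, ∀ u : E, u ≠ 0 → 0 < secondDeriv t₁ x u u) ∧
        (∀ x : E, r / 2 ≤ ‖x‖ → t₁ x = t₀ x) ∧
        (∀ x : E, |t₁ x - t₀ x| < ε) := by
  intro r hr ε hε
  set R := min ρ (r / 2)
  have hRpos : 0 < R := lt_min hρ (by linarith)
  set η := min (ε / 5) (δ * R ^ 2 / 128)
  have hη : 0 < η := lt_min (by linarith) (by positivity)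
  have hηε : 4 * η < ε := by linarith [min_le_left (ε / 5) (δ * R ^ 2 / 128)]
  have hηR : 128 * η ≤ δ * R ^ 2 := by linarith [min_le_right (ε / 5) (δ * R ^ 2 / 128)]
  obtain ⟨l, c, hle, hc⟩ := hconv.exists_affine_le_of_lt (𝕜 := ℝ) (mem_univ 0)
    (show t₀ 0 - η < t₀ 0 by linarith) isClosed_univ
    (hcont.lowerSemicontinuous.lowerSemicontinuousOn _)
  have hl : ∀ x, l x + c ≤ t₀ x := fun x => by simpa using hle ⟨x, mem_univ x⟩
  have hc : c = t₀ 0 - η := by simpa using hc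
  have htop : ((2 : ℕ∞) : WithTop ℕ∞) ≤ ((⊤ : ℕ∞) : WithTop ℕ∞) := by exact_mod_cast le_top
  have hat : ∀ x : E, x ≠ 0 → ContDiffAt ℝ (⊤ : ℕ∞) t₀ x := fun x hx =>
    hsmooth.contDiffAt (isOpen_compl_singleton.mem_nhds hx)
  have hgrow : ∀ x : E, ‖x‖ < R → l x + c + δ / 4 * ‖x‖ ^ 2 - η ≤ t₀ x := fun x hx => by
    have := quadratic_growth_of_secondDeriv hcont (hsmooth.of_le htop) hbound l c hl
      (hx.trans_le (min_le_left _ _))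
    linarith
  obtain ⟨g, hg, hgmono, hg0, hg1, hgid, κ, hgκ⟩ := exists_smooth_positivePart (half_pos hη)
  have hgd : Differentiable ℝ g := hg.differentiable (by simp)
  have hgm : Monotone g := monotone_of_deriv_nonneg hgd hg0
  have hgm' : Monotone fun s => s - g s :=
    monotone_of_deriv_nonneg (differentiable_id.sub hgd) fun s => by
      have hs : HasDerivAt (fun s => s - g s) (1 - deriv g s) s :=
        (hasDerivAt_id s).sub (hgd s).hasDerivAt
      rw [hs.deriv]
      linarith [hg1 s]
  have hgz : g 0 = 0 := hgid 0 le_rfl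
  set q : E → ℝ := fun x => l x + (c + 2 * η) + δ / 8 * ‖x‖ ^ 2 with hq
  have hqs : ContDiff ℝ (⊤ : ℕ∞) q :=
    (l.contDiff.add contDiff_const).add (contDiff_const.mul (contDiff_norm_sq ℝ))
  have hqq : ∀ x u : E, u ≠ 0 → 0 < secondDeriv q x u u := fun x u hu => by
    have := norm_pos_iff.2 hu
    rw [hq, secondDeriv_quadratic]
    positivity
  set F : E → ℝ := fun x => if ‖x‖ < R then q x + g (t₀ x - q x) else t₀ x with hF
  have hlow : ∀ x : E, ‖x‖ < R → -(4 * η) ≤ t₀ x - q x := fun x hx => by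
    have : 0 ≤ δ / 8 * ‖x‖ ^ 2 := by positivity
    simp only [hq]
    linarith [hgrow x hx]
  have hFout : ∀ x : E, R / 2 < ‖x‖ → F x = t₀ x := fun x hx => by
    simp only [hF]
    split_ifs with h
    · have h2 : (R / 2) ^ 2 ≤ ‖x‖ ^ 2 := by gcongr
      have h3 : 0 ≤ t₀ x - q x := by
        simp only [hq]
        nlinarith [hgrow x h, mul_le_mul_of_nonneg_left h2 hδ.le]
      rw [hgid _ h3]
      ring
    · rfl
  have hFin : ∀ x : E, ‖x‖ < R → F =ᶠ[𝓝 x] fun y => q y + g (t₀ y - q y) := fun x hx => by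
    filter_upwards [continuous_norm.continuousAt.eventually_lt_const hx] with y hy
    exact if_pos hy
  have hFout' : ∀ x : E, R / 2 < ‖x‖ → F =ᶠ[𝓝 x] t₀ := fun x hx => by
    filter_upwards [continuous_norm.continuousAt.eventually_const_lt hx] with y hy
    exact hFout y hy
  have hFzero : F =ᶠ[𝓝 0] fun y => l y + (c + 2 * η + κ) + δ / 8 * ‖y‖ ^ 2 := by
    have h0 : t₀ 0 - q 0 < -(η / 2) := by
      simp [hq, hc]
      linarith
    filter_upwards [hFin 0 (by simpa using hRpos),
      (hcont.sub hqs.continuous).continuousAt.eventually_lt_const h0] with y hy hy'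
    rw [hy, hgκ (t₀ y - q y) hy'.le]
    simp only [hq]
    ring
  refine ⟨F, contDiff_iff_contDiffAt.2 fun x => ?_, fun x u hu => ?_, fun x hx => ?_, fun x => ?_⟩
  · rcases eq_or_ne x 0 with rfl | hx
    · refine ContDiffAt.congr_of_eventuallyEq ?_ hFzero
      exact ((l.contDiff.add contDiff_const).add
        (contDiff_const.mul (contDiff_norm_sq ℝ))).contDiffAt
    rcases lt_or_ge ‖x‖ R with h | h
    · refine ContDiffAt.congr_of_eventuallyEq ?_ (hFin x h)
      exact hqs.contDiffAt.add (hg.contDiffAt.comp x ((hat x hx).sub hqs.contDiffAt))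
    · exact (hat x hx).congr_of_eventuallyEq (hFout' x (by linarith))
  · rcases eq_or_ne x 0 with rfl | hx
    · have := norm_pos_iff.2 hu
      rw [secondDeriv_congr hFzero, secondDeriv_quadratic]
      positivity
    rcases lt_or_ge ‖x‖ R with h | h
    · rw [secondDeriv_congr (hFin x h), secondDeriv_add_comp_sub ((hat x hx).of_le htop)
        (hqs.contDiffAt.of_le htop) (hg.of_le htop)]
      have h1 := hqq x u hu
      have h2 := hposdef x hx u hu
      have h3 : 0 ≤ deriv (deriv g) (t₀ x - q x) := hgmono.deriv_nonneg
      have h4 := hg0 (t₀ x - q x)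
      have h5 := hg1 (t₀ x - q x)
      have h6 : 0 < (1 - deriv g (t₀ x - q x)) * secondDeriv q x u u
          + deriv g (t₀ x - q x) * secondDeriv t₀ x u u := by
        rcases h4.eq_or_lt with h | h
        · rw [← h]
          linarith
        · exact add_pos_of_nonneg_of_pos (mul_nonneg (by linarith) h1.le) (mul_pos h h2)
      exact add_pos_of_pos_of_nonneg h6 (mul_nonneg h3 (sq_nonneg _))
    · rw [secondDeriv_congr (hFout' x (by linarith))]
      exact hposdef x hx u hu
  · exact hFout x (by linarith [min_le_right ρ (r / 2)])
  · simp only [hF]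
    split_ifs with h
    · have hs := hlow x h
      rw [abs_lt]
      rcases le_total 0 (t₀ x - q x) with h0 | h0
      · rw [hgid _ h0]
        constructor <;> linarith
      · have h1 := hgm h0
        have h2 := hgm' h0
        simp only [hgz] at h1 h2
        constructor <;> linarith
    · simpa using hε
end
end

section
/- Let A ⊆ V ∖ {0} be an open convex conic salient subset and F : A → (0,∞) a smooth (at least C²) positively 1-homogeneous function such that the fundamental tensor g_v of L := F² is nondegenerate with index n−1 for every v ∈ A. Then the reverse fundamental inequality holds: g_v(v,w) ≥ F(v)·F(w) for all v, w ∈ A, with equality if and only if w = λv for some λ > 0. -/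
open Set Module

noncomputable section

variable {V : Type*} [NormedAddCommGroup V] [NormedSpace ℝ V]

/-- Salient: contains no pair of opposite vectors. -/
def Salient (s : Set V) : Prop := ∀ v ∈ s, -v ∉ s

/-- Reverse Cauchy–Schwarz inequality for a symmetric form that is negative definite on a
hyperplane and positive at `v`. -/
theorem reverse_cauchy_schwarz [FiniteDimensional ℝ V] (B : V →L[ℝ] V →L[ℝ] ℝ)
    (hsymm : ∀ x y, B x y = B y x) (W : Submodule ℝ V)
    (hW : finrank ℝ W = finrank ℝ V - 1) (hneg : ∀ x ∈ W, x ≠ 0 → B x x < 0)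
    {v : V} (hv : 0 < B v v) {u : V} (hu : ∀ c : ℝ, u ≠ c • v) :
    B u u * B v v < B v u ^ 2 := by
  have hv0 : v ≠ 0 := by rintro rfl; simp at hv
  have hvW : v ∉ W := fun h => (hneg v h hv0).not_gt hv
  have hlt : W < W ⊔ Submodule.span ℝ {v} := by
    refine lt_of_le_of_ne le_sup_left fun h => hvW ?_
    rw [h]
    exact Submodule.mem_sup_right (Submodule.mem_span_singleton_self v)
  have hfin := Submodule.finrank_lt_finrank_of_lt hlt
  have hle := Submodule.finrank_le (W ⊔ Submodule.span ℝ {v})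
  have htop : W ⊔ Submodule.span ℝ {v} = ⊤ :=
    Submodule.eq_top_of_finrank_eq (by omega)
  obtain ⟨y, hy, z, hz, hyz⟩ := Submodule.mem_sup.1 (htop ▸ Submodule.mem_top : u ∈ _)
  obtain ⟨c, rfl⟩ := Submodule.mem_span_singleton.1 hz
  have hy0 : y ≠ 0 := by
    rintro rfl
    exact hu c (by simpa using hyz.symm)
  have hyneg := mul_neg_of_neg_of_pos (hneg y hy hy0) hv
  subst hyz
  simp only [map_add, map_smul, add_apply, smul_apply,
    smul_eq_mul, hsymm y v]
  nlinarith [sq_nonneg (B v y)]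

/-- Euler's identity for a 2-homogeneous function. -/
theorem fderiv_apply_self_of_homogeneous_two {L : V → ℝ} {v : V}
    (hL : DifferentiableAt ℝ L v) (hhom : ∀ c : ℝ, 0 < c → L (c • v) = c ^ 2 * L v) :
    fderiv ℝ L v v = 2 * L v := by
  have h1 : HasDerivAt (fun c : ℝ => c • v) v 1 := by
    simpa using (hasDerivAt_id (1 : ℝ)).smul_const v
  have h2 : HasDerivAt (fun c : ℝ => L (c • v)) (fderiv ℝ L v v) 1 := by
    have hL' : HasFDerivAt L (fderiv ℝ L v) ((1 : ℝ) • v) := by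
      simpa using hL.hasFDerivAt
    exact hL'.comp_hasDerivAt (1 : ℝ) h1
  have h3 : HasDerivAt (fun c : ℝ => c ^ 2 * L v) (2 * L v) 1 := by
    simpa using (hasDerivAt_pow 2 (1 : ℝ)).mul_const (L v)
  refine h2.unique (h3.congr_of_eventuallyEq ?_)
  filter_upwards [lt_mem_nhds one_pos] with c hc using hhom c hc

/-- The derivative of a 2-homogeneous function is 1-homogeneous. -/
theorem fderiv_smul_of_homogeneous_two {L : V → ℝ} {A : Set V} (hA : IsOpen A)
    (hAconic : Conic A) (hL : DifferentiableOn ℝ L A)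
    (hhom : ∀ v ∈ A, ∀ c : ℝ, 0 < c → L (c • v) = c ^ 2 * L v)
    {v : V} (hv : v ∈ A) {c : ℝ} (hc : 0 < c) :
    fderiv ℝ L (c • v) = c • fderiv ℝ L v := by
  have hcv := (hL.differentiableAt (hA.mem_nhds (hAconic v hv c hc))).hasFDerivAt
  have h1 : HasFDerivAt (fun x : V => c • x) (c • ContinuousLinearMap.id ℝ V) v :=
    (hasFDerivAt_id v).const_smul c
  have h2 := hcv.comp v h1
  have h3 := (hL.differentiableAt (hA.mem_nhds hv)).hasFDerivAt.const_mul (c ^ 2)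
  have h4 := h2.unique (h3.congr_of_eventuallyEq (by
    filter_upwards [hA.mem_nhds hv] with x hx using hhom x hx c hc))
  ext u
  have h5 := DFunLike.congr_fun h4 u
  simp only [ContinuousLinearMap.comp_apply, smul_apply, map_smul,
    ContinuousLinearMap.id_apply, smul_eq_mul] at h5 ⊢
  exact mul_left_cancel₀ hc.ne' (by linarith)

/-- Euler's identity for the derivative of a 2-homogeneous function. -/
theorem fderiv_fderiv_apply_self_of_homogeneous_two {L : V → ℝ} {A : Set V} (hA : IsOpen A)
    (hAconic : Conic A) (hL : ContDiffOn ℝ 2 L A)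
    (hhom : ∀ v ∈ A, ∀ c : ℝ, 0 < c → L (c • v) = c ^ 2 * L v) {v : V} (hv : v ∈ A) :
    fderiv ℝ (fderiv ℝ L) v v = fderiv ℝ L v := by
  have hD : DifferentiableAt ℝ (fderiv ℝ L) v :=
    ((hL.contDiffAt (hA.mem_nhds hv)).fderiv_right (m := 1) (by norm_num)).differentiableAt
      (by norm_num)
  have h1 : HasDerivAt (fun c : ℝ => c • v) v 1 := by
    simpa using (hasDerivAt_id (1 : ℝ)).smul_const v
  have h2 : HasDerivAt (fun c : ℝ => fderiv ℝ L (c • v)) (fderiv ℝ (fderiv ℝ L) v v) 1 := by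
    have hD' : HasFDerivAt (fderiv ℝ L) (fderiv ℝ (fderiv ℝ L) v) ((1 : ℝ) • v) := by
      simpa using hD.hasFDerivAt
    exact hD'.comp_hasDerivAt (1 : ℝ) h1
  have h3 : HasDerivAt (fun c : ℝ => c • fderiv ℝ L v) (fderiv ℝ L v) 1 := by
    simpa using (hasDerivAt_id (1 : ℝ)).smul_const (fderiv ℝ L v)
  refine h2.unique (h3.congr_of_eventuallyEq ?_)
  filter_upwards [lt_mem_nhds one_pos] with c hc using
    fderiv_smul_of_homogeneous_two hA hAconic (hL.differentiableOn (by norm_num)) hhom hv hc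

/-- A function with negative second derivative on `[0, 1]` lies strictly below its tangent at `0`. -/
theorem lt_add_deriv_of_second_deriv_neg {f f' f'' : ℝ → ℝ}
    (hf : ∀ t ∈ Icc (0 : ℝ) 1, HasDerivAt f (f' t) t)
    (hf' : ∀ t ∈ Icc (0 : ℝ) 1, HasDerivAt f' (f'' t) t)
    (hneg : ∀ t ∈ Icc (0 : ℝ) 1, f'' t < 0) : f 1 < f 0 + f' 0 := by
  have hanti : StrictAntiOn f' (Icc (0 : ℝ) 1) := by
    refine strictAntiOn_of_deriv_neg (convex_Icc 0 1)
      (fun t ht => (hf' t ht).continuousAt.continuousWithinAt) fun t ht => ?_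
    have ht' := interior_subset ht
    rw [(hf' t ht').deriv]
    exact hneg t ht'
  obtain ⟨c, hc, hfc⟩ := exists_hasDerivAt_eq_slope f f' zero_lt_one
    (fun t ht => (hf t ht).continuousAt.continuousWithinAt)
    (fun t ht => hf t (Ioo_subset_Icc_self ht))
  have := hanti (left_mem_Icc.2 zero_le_one) (Ioo_subset_Icc_self hc) hc.1
  simp only [sub_zero, div_one] at hfc
  linarith

/-- the (strict) reverse fundamental inequality for a Lorentz-Minkowski
norm on a convex conic salient domain. -/
theorem stmt_7 [FiniteDimensional ℝ V] (hn : 2 ≤ finrank ℝ V)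
    (A : Set V) (hA : A.Nonempty) (hA0 : (0 : V) ∉ A) (hAop : IsOpen A)
    (hAconv : Convex ℝ A) (hAconic : Conic A) (hAsal : Salient A)
    (F : V → ℝ) (hFpos : ∀ v ∈ A, 0 < F v)
    (hFsmooth : ContDiffOn ℝ 2 F A) (hFhom : PosHom1 F A)
    (hLor : ∀ v ∈ A, IsLorentzForm (fundTensor (fun x => F x ^ 2) v)) :
    ∀ v ∈ A, ∀ w ∈ A,
      F v * F w ≤ fundTensor (fun x => F x ^ 2) v v w ∧
      (fundTensor (fun x => F x ^ 2) v v w = F v * F w ↔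
        ∃ c : ℝ, 0 < c ∧ w = c • v) := by
  set L : V → ℝ := fun x => F x ^ 2 with hLdef
  have hL : ContDiffOn ℝ 2 L A := hFsmooth.pow 2
  have hhom : ∀ v ∈ A, ∀ c : ℝ, 0 < c → L (c • v) = c ^ 2 * L v := fun v hv c hc => by
    simp only [hLdef, hFhom v hv c hc, mul_pow]
  have hLdiff : ∀ v ∈ A, HasFDerivAt L (fderiv ℝ L v) v := fun v hv =>
    ((hL.contDiffAt (hAop.mem_nhds hv)).differentiableAt (by norm_num)).hasFDerivAt
  have hDdiff : ∀ v ∈ A, HasFDerivAt (fderiv ℝ L) (fderiv ℝ (fderiv ℝ L) v) v := fun v hv =>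
    (((hL.contDiffAt (hAop.mem_nhds hv)).fderiv_right (m := 1) (by norm_num)).differentiableAt
      (by norm_num)).hasFDerivAt
  have hEuler : ∀ v ∈ A, fderiv ℝ L v v = 2 * F v ^ 2 := fun v hv =>
    fderiv_apply_self_of_homogeneous_two (hLdiff v hv).differentiableAt (hhom v hv)
  have hEuler' : ∀ v ∈ A, fderiv ℝ (fderiv ℝ L) v v = fderiv ℝ L v := fun v hv =>
    fderiv_fderiv_apply_self_of_homogeneous_two hAop hAconic hL hhom hv
  have hF' : ∀ v ∈ A, ∀ u, 2 * F v * fderiv ℝ F v u = fderiv ℝ L v u := fun v hv u => by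
    have h := (((hFsmooth.contDiffAt (hAop.mem_nhds hv)).differentiableAt
      (by norm_num)).hasFDerivAt.pow 2).fderiv
    rw [show fderiv ℝ L v = _ from h]
    simp
  have hCS : ∀ v ∈ A, ∀ u, (∀ c : ℝ, u ≠ c • v) →
      fderiv ℝ (fderiv ℝ L) v u u * (2 * F v ^ 2) < fderiv ℝ L v u ^ 2 := fun v hv u hu => by
    obtain ⟨-, W, hW, hneg⟩ := hLor v hv
    have hsymm : IsSymmSndFDerivAt ℝ L v :=
      (hL.contDiffAt (hAop.mem_nhds hv)).isSymmSndFDerivAt (by simp)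
    have h := reverse_cauchy_schwarz (fderiv ℝ (fderiv ℝ L) v) (fun x y => hsymm x y) W hW
      (fun x hx hx0 => by have := hneg x hx hx0; unfold fundTensor at this; linarith)
      (v := v) (by rw [hEuler' v hv, hEuler v hv]; have := hFpos v hv; positivity) hu
    rwa [hEuler' v hv, hEuler v hv] at h
  intro v hv w hw
  have hFv := hFpos v hv
  have hg : ∀ u, fundTensor L v v u = (1 / 2) * fderiv ℝ L v u := fun u => by
    rw [fundTensor, hEuler' v hv]
  by_cases hpar : ∃ c : ℝ, 0 < c ∧ w = c • v
  · have heq : fundTensor L v v w = F v * F w := by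
      obtain ⟨c, hc, rfl⟩ := hpar
      rw [hg, map_smul, hEuler v hv, hFhom v hv c hc, smul_eq_mul]
      ring
    exact ⟨heq.ge, iff_of_true heq hpar⟩
  suffices hlt : F v * F w < fundTensor L v v w from
    ⟨hlt.le, iff_of_false hlt.ne' hpar⟩
  have hnot : ∀ c : ℝ, w ≠ c • v := by
    rintro c rfl
    rcases lt_trichotomy c 0 with hc | rfl | hc
    · refine hAsal v hv ?_
      have := hAconic _ hw (-c)⁻¹ (inv_pos.2 (neg_pos.2 hc))
      rwa [smul_smul, inv_neg, neg_mul, inv_mul_cancel₀ hc.ne, neg_one_smul] at this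
    · exact hA0 (by simpa using hw)
    · exact hpar ⟨c, hc, rfl⟩
  set γ : ℝ → V := fun t => v + t • (w - v) with hγ
  have hγA : ∀ t ∈ Icc (0 : ℝ) 1, γ t ∈ A := fun t ht =>
    hAconv.add_smul_sub_mem hv hw ht
  have hγ' : ∀ t, HasDerivAt γ (w - v) t := fun t => by
    simpa [hγ] using (hasDerivAt_id t).smul_const (w - v)
  have hγpar : ∀ t, ∀ c : ℝ, w - v ≠ c • γ t := fun t c h => by
    have h1 : (1 - c * t) • w = (1 + c - c * t) • v := by
      have : w - v - c • (v + t • (w - v)) = 0 := sub_eq_zero.2 h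
      rw [← sub_eq_zero, ← this]
      module
    by_cases h0 : 1 - c * t = 0
    · rw [h0, zero_smul, eq_comm, smul_eq_zero] at h1
      rcases h1 with h1 | rfl
      · have hc : c = 0 := by linarith
        simp [hc] at h0
      · exact hA0 hv
    · refine hnot ((1 - c * t)⁻¹ * (1 + c - c * t)) ?_
      rw [mul_smul, ← h1, smul_smul, inv_mul_cancel₀ h0, one_smul]
  have hf : ∀ t ∈ Icc (0 : ℝ) 1, HasDerivAt (fun t => F (γ t))
      (fderiv ℝ L (γ t) (w - v) / (2 * F (γ t))) t := fun t ht => by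
    have hpos := hFpos _ (hγA t ht)
    have h := (((hFsmooth.contDiffAt (hAop.mem_nhds (hγA t ht))).differentiableAt
      (by norm_num)).hasFDerivAt).comp_hasDerivAt t (hγ' t)
    rw [← hF' _ (hγA t ht), mul_div_cancel_left₀ _ (by positivity)]
    exact h
  have hl : ∀ t ∈ Icc (0 : ℝ) 1, HasDerivAt (fun t => fderiv ℝ L (γ t) (w - v))
      (fderiv ℝ (fderiv ℝ L) (γ t) (w - v) (w - v)) t := fun t ht => by
    simpa using ((hDdiff _ (hγA t ht)).comp_hasDerivAt t (hγ' t)).clm_apply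
      (hasDerivAt_const t (w - v))
  have hmain := lt_add_deriv_of_second_deriv_neg hf
    (fun t ht => (hl t ht).fun_div ((hf t ht).const_mul 2)
      (by have := hFpos _ (hγA t ht); positivity))
    (fun t ht => by
      have hpos := hFpos _ (hγA t ht)
      have h := hCS _ (hγA t ht) (w - v) (hγpar t)
      refine div_neg_of_neg_of_pos ?_ (by positivity)
      rw [sub_neg, ← sub_pos]
      have e : fderiv ℝ L (γ t) (w - v) * (2 * (fderiv ℝ L (γ t) (w - v) / (2 * F (γ t))))
          - fderiv ℝ (fderiv ℝ L) (γ t) (w - v) (w - v) * (2 * F (γ t))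
          = (fderiv ℝ L (γ t) (w - v) ^ 2
            - fderiv ℝ (fderiv ℝ L) (γ t) (w - v) (w - v) * (2 * F (γ t) ^ 2)) / F (γ t) := by
        field_simp
      rw [e]
      exact div_pos (sub_pos.2 h) hpos)
  have h0 : γ 0 = v := by simp [hγ]
  have h1 : γ 1 = w := by simp [hγ]
  rw [h0, h1, map_sub, hEuler v hv] at hmain
  have e : F v + (fderiv ℝ L v w - 2 * F v ^ 2) / (2 * F v)
      = fderiv ℝ L v w / (2 * F v) := by
    field_simp
    ring
  rw [e, lt_div_iff₀ (by positivity)] at hmain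
  rw [hg]
  linarith
end
end

section
/- Let A* ⊆ V ∖ {0} be a nonempty open conic set and L : A* → ℝ a smooth (C^∞) positively 2-homogeneous function whose fundamental tensor g_v is nondegenerate with index n−1 at every v ∈ A*. Let A be a connected component of {v ∈ A* : L(v) > 0} and assume that the closure Ā of A in V ∖ {0} is contained in A*. Then A is conic, and every v in C := Ā ∖ A satisfies L(v) = 0 and DL(v) ≠ 0; in particular, the restriction of L to A is a properly Lorentz-Minkowski norm with cone domain A. -/
open Set Module

noncomputable section

variable {V : Type*} [NormedAddCommGroup V] [NormedSpace ℝ V]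

/-- The positivity set of a function continuous on an open set is open. -/
theorem isOpen_pos_of_continuousOn {X : Type*} [TopologicalSpace X] {s : Set X} {f : X → ℝ}
    (hs : IsOpen s) (hf : ContinuousOn f s) : IsOpen {v ∈ s | 0 < f v} :=
  hf.isOpen_inter_preimage hs isOpen_Ioi

/-- A connected component of a set is relatively closed in it, when the set is open. -/
theorem mem_connectedComponentIn_of_mem_closure {X : Type*} [TopologicalSpace X]
    [LocallyConnectedSpace X] {U : Set X} (hU : IsOpen U) {x v : X}
    (hv : v ∈ closure (connectedComponentIn U x)) (hvU : v ∈ U) :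
    v ∈ connectedComponentIn U x := by
  obtain ⟨w, hwv, hwx⟩ := mem_closure_iff.1 hv _ hU.connectedComponentIn
    (mem_connectedComponentIn hvU)
  rw [connectedComponentIn_eq hwx, ← connectedComponentIn_eq hwv]
  exact mem_connectedComponentIn hvU

/-- A connected component of a conic set is conic. -/
theorem Conic.connectedComponentIn {U : Set V} (hU : Conic U) (x : V) :
    Conic (connectedComponentIn U x) := by
  intro v hv c hc
  have hvU := connectedComponentIn_subset U x hv
  have hray : IsPreconnected ((fun t : ℝ => t • v) '' Ioi 0) :=
    isPreconnected_Ioi.image _ (by fun_prop)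
  have hsub : (fun t : ℝ => t • v) '' Ioi 0 ⊆ U := by
    rintro _ ⟨t, ht, rfl⟩
    exact hU v hvU t ht
  rw [connectedComponentIn_eq hv]
  exact hray.subset_connectedComponentIn ⟨1, by simp, by simp⟩ hsub ⟨c, hc, rfl⟩

/-- The derivative of a positively 2-homogeneous function is positively 1-homogeneous. -/
theorem PosHom2.fderiv_smul {s : Set V} {L : V → ℝ} (hs : IsOpen s) (hL : PosHom2 L s)
    {v : V} (hv : v ∈ s) {c : ℝ} (hc : 0 < c) :
    fderiv ℝ L (c • v) = c • fderiv ℝ L v := by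
  have heq : (fun w => L (c • w)) =ᶠ[nhds v] fun w => c ^ 2 • L w := by
    filter_upwards [hs.mem_nhds hv] with w hw
    simpa using hL w hw c hc
  have h := heq.fderiv_eq (𝕜 := ℝ)
  rw [fderiv_comp_smul, show (fun w => c ^ 2 • L w) = c ^ 2 • L from rfl, fderiv_const_smul_field,
    Pi.smul_apply] at h
  have key : c • fderiv ℝ L (c • v) = c • c • fderiv ℝ L v := by
    rw [h, smul_smul, sq]
  exact smul_right_injective (V →L[ℝ] ℝ) hc.ne' key

/-- Euler's identity for the derivative of a positively 2-homogeneous function. -/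
theorem PosHom2.fderiv_fderiv_self {s : Set V} {L : V → ℝ} (hs : IsOpen s) (hL : PosHom2 L s)
    {v : V} (hv : v ∈ s) (hd : DifferentiableAt ℝ (fderiv ℝ L) v) :
    fderiv ℝ (fderiv ℝ L) v v = fderiv ℝ L v := by
  have h₁ : HasDerivAt (fun t : ℝ => fderiv ℝ L (t • v)) (fderiv ℝ (fderiv ℝ L) v v) 1 := by
    have hray : HasDerivAt (fun t : ℝ => t • v) v 1 := by
      simpa using (hasDerivAt_id (1 : ℝ)).smul_const v
    exact HasFDerivAt.comp_hasDerivAt_of_eq 1 hd.hasFDerivAt hray (one_smul ℝ v).symm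
  have h₂ : HasDerivAt (fun t : ℝ => t • fderiv ℝ L v) (fderiv ℝ L v) 1 := by
    simpa using (hasDerivAt_id (1 : ℝ)).smul_const (fderiv ℝ L v)
  refine h₁.unique (h₂.congr_of_eventuallyEq ?_)
  filter_upwards [Ioi_mem_nhds (zero_lt_one' ℝ)] with t ht
  exact hL.fderiv_smul hs hv ht

/-- a connected component of the positivity set of a Beem-type metric,
with closure inside the domain, is the cone domain of a properly Lorentz-Minkowski
norm. -/
theorem stmt_9 [FiniteDimensional ℝ V] (hn : 2 ≤ finrank ℝ V)
    (Astar : Set V) (hNe : Astar.Nonempty) (hop : IsOpen Astar)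
    (hconic : Conic Astar) (h0 : (0 : V) ∉ Astar)
    (L : V → ℝ) (hsmooth : ContDiffOn ℝ (⊤ : ℕ∞) L Astar) (hhom : PosHom2 L Astar)
    (hLor : ∀ v ∈ Astar, IsLorentzForm (fundTensor L v))
    (A : Set V) (x : V) (hx : x ∈ Astar ∧ 0 < L x)
    (hAcomp : A = connectedComponentIn {v ∈ Astar | 0 < L v} x)
    (hclos : closure A \ {0} ⊆ Astar) :
    Conic A ∧
    (∀ v ∈ (closure A \ {0}) \ A, L v = 0 ∧ fderiv ℝ L v ≠ 0) ∧
    IsProperLMNorm L A := by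
  have hU : IsOpen {v ∈ Astar | 0 < L v} :=
    isOpen_pos_of_continuousOn hop hsmooth.continuousOn
  have hUconic : Conic {v ∈ Astar | 0 < L v} := fun v hv c hc =>
    ⟨hconic v hv.1 c hc, by rw [hhom v hv.1 c hc]; have := hv.2; positivity⟩
  have hAU : A ⊆ {v ∈ Astar | 0 < L v} := hAcomp ▸ connectedComponentIn_subset _ _
  have hAconic : Conic A := hAcomp ▸ hUconic.connectedComponentIn x
  have hzero : ∀ v ∈ (closure A \ {0}) \ A, L v = 0 := by
    intro v hv
    have hvs := hclos hv.1
    have hcont : ContinuousAt L v := hsmooth.continuousOn.continuousAt (hop.mem_nhds hvs)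
    have hnonneg : 0 ≤ L v :=
      isClosed_Ici.closure_subset (hcont.continuousWithinAt.mem_closure hv.1.1
        fun w hw => (hAU hw).2.le)
    by_contra hne
    subst hAcomp
    exact hv.2 (mem_connectedComponentIn_of_mem_closure hU hv.1.1
      ⟨hvs, lt_of_le_of_ne hnonneg (Ne.symm hne)⟩)
  refine ⟨hAconic, fun v hv => ⟨hzero v hv, fun hdL => ?_⟩, ?_⟩
  · have hvs := hclos hv.1
    have hd : DifferentiableAt ℝ (fderiv ℝ L) v :=
      ((hsmooth.contDiffAt (hop.mem_nhds hvs)).fderiv_right (m := 1)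
        (WithTop.coe_le_coe.2 (le_top : (1 + 1 : ℕ∞) ≤ ⊤))).differentiableAt one_ne_zero
    refine hv.1.2 ((hLor v hvs).1 v fun w => ?_)
    simp [fundTensor, hhom.fderiv_fderiv_self hop hvs hd, hdL]
  · exact
      { nonempty := ⟨x, hAcomp ▸ mem_connectedComponentIn hx⟩
        zero_not_mem := fun h => h0 (hAU h).1
        isOpen := hAcomp ▸ hU.connectedComponentIn
        isConnected := hAcomp ▸ isConnected_connectedComponentIn_iff.2 hx
        conic := hAconic
        pos := fun v hv => (hAU hv).2
        zero_on_bd := hzero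
        smooth_ext := ⟨Astar, hop, hconic, h0, hclos, hsmooth, hhom⟩
        lorentz := fun v hv => hLor v (hclos hv) }
end
end

section
/- Let N be a real finite-dimensional normed vector space, U ⊆ N open, and L1, L2 : U → ℝ smooth (C^∞) functions. Let A ⊆ U be open and connected with L1 > 0 and L2 > 0 on A, and let C denote the topological boundary of A inside U; assume L1 = L2 = 0 on C and that DL1(x) ≠ 0 and DL2(x) ≠ 0 for every x ∈ C. Then: (a) there exists a function μ : A ∪ C → ℝ with μ = L2/L1 on A, μ > 0 on A ∪ C, and μ smooth on A ∪ C (in the within-set sense); and (b) the function √(L1·L2) is smooth on A ∪ C (in the within-set sense). -/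
open Set

noncomputable section

open Filter Topology
open scoped ContDiff

theorem contDiff_intervalIntegral_param_nat {E F : Type*}
    [NormedAddCommGroup E] [NormedSpace ℝ E] [FiniteDimensional ℝ E]
    [NormedAddCommGroup F] [NormedSpace ℝ F] [CompleteSpace F] (a b : ℝ) (f : E × ℝ → F) (n : ℕ)
    (hf : ContDiff ℝ n f) :
    ContDiff ℝ n (fun x => ∫ t in a..b, f (x, t)) := by
  induction n generalizing f with
  | zero =>
    simp only [Nat.cast_zero, contDiff_zero] at hf ⊢
    exact intervalIntegral.continuous_parametric_intervalIntegral_of_continuous'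
      (f := fun x t => f (x, t)) hf a b
  | succ n ih =>
    push_cast at hf ⊢
    have hdiff : Differentiable ℝ f := hf.differentiable (by simp)
    have hfd : ContDiff ℝ n (fderiv ℝ f) := (contDiff_succ_iff_fderiv.1 hf).2.2
    set f' : E × ℝ → E →L[ℝ] F :=
      fun p => (fderiv ℝ f p).comp (ContinuousLinearMap.inl ℝ E ℝ)
    have hf'n : ContDiff ℝ n f' := hfd.clm_comp contDiff_const
    have hf'c : Continuous f' := hf'n.continuous
    refine contDiff_succ_iff_hasFDerivAt.2 ⟨fun x => ∫ t in a..b, f' (x, t), ?_, fun x => ?_⟩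
    · refine contDiff_clm_apply_iff.2 fun w => ?_
      have h := ih (fun p => f' p w) (hf'n.clm_apply contDiff_const)
      convert! h using 2 with x
      exact ContinuousLinearMap.intervalIntegral_apply
        ((hf'c.comp (by fun_prop)).intervalIntegrable _ _) w
    have hK : IsCompact (Metric.closedBall x 1 ×ˢ uIcc a b) :=
      (isCompact_closedBall x 1).prod isCompact_uIcc
    obtain ⟨M, hM⟩ := hK.exists_bound_of_continuousOn hf'c.continuousOn
    refine intervalIntegral.hasFDerivAt_integral_of_dominated_of_fderiv_le
      (F := fun x t => f (x, t)) (F' := fun x t => f' (x, t)) (bound := fun _ => M)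
      (Metric.closedBall_mem_nhds x one_pos) (Eventually.of_forall fun y => ?_) ?_ ?_ ?_ ?_ ?_
    · exact (hdiff.continuous.comp (by fun_prop)).aestronglyMeasurable
    · exact (hdiff.continuous.comp (by fun_prop)).intervalIntegrable _ _
    · exact (hf'c.comp (by fun_prop)).aestronglyMeasurable
    · exact Eventually.of_forall fun t ht y hy => hM (y, t) ⟨hy, uIoc_subset_uIcc ht⟩
    · exact intervalIntegrable_const
    · exact Eventually.of_forall fun t _ y _ =>
        (hdiff (y, t)).hasFDerivAt.comp y (hasFDerivAt_prodMk_left y t)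

/-- **Hadamard's lemma** for a globally defined function vanishing on a hyperplane. -/
theorem ContDiff.exists_eq_mul_of_eq_zero_on_ker {E : Type*}
    [NormedAddCommGroup E] [NormedSpace ℝ E] [FiniteDimensional ℝ E]
    (l : E →L[ℝ] ℝ) (v : E) (hv : l v = 1) (n : ℕ) (G : E → ℝ)
    (hG : ContDiff ℝ (n + 1) G) (hG0 : ∀ y, l y = 0 → G y = 0) :
    ∃ g : E → ℝ, ContDiff ℝ n g ∧ ∀ y, G y = g y * l y := by
  have hfd : ContDiff ℝ n (fderiv ℝ G) := (contDiff_succ_iff_fderiv.1 hG).2.2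
  have hdiff : Differentiable ℝ G := hG.differentiable (by simp)
  set f : E × ℝ → ℝ := fun p => fderiv ℝ G (p.1 - (1 - p.2) • l p.1 • v) v with hf
  have hfn : ContDiff ℝ n f := by
    refine ContDiff.clm_apply (hfd.comp ?_) contDiff_const
    fun_prop
  refine ⟨_, contDiff_intervalIntegral_param_nat 0 1 f n hfn, fun y => ?_⟩
  have key : ∀ t ∈ uIcc (0 : ℝ) 1,
      HasDerivAt (fun t : ℝ => G (y - (1 - t) • l y • v)) (f (y, t) * l y) t := by
    intro t _
    have h1 : HasDerivAt (fun t : ℝ => y - (1 - t) • l y • v) (l y • v) t := by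
      simpa using (((hasDerivAt_id t).const_sub 1).smul_const (l y • v)).const_sub y
    have h2 := (hdiff (y - (1 - t) • l y • v)).hasFDerivAt.comp_hasDerivAt t h1
    simpa [hf, mul_comm, Function.comp_def] using h2
  have h := intervalIntegral.integral_eq_sub_of_hasDerivAt key
    (((hfn.continuous.comp (by fun_prop)).mul continuous_const).intervalIntegrable _ _)
  rw [intervalIntegral.integral_mul_const] at h
  rw [h, hG0 (y - (1 - (0 : ℝ)) • l y • v) (by simp [hv])]
  simp

theorem ContDiffAt.exists_eq_mul_of_eq_zero_on_ker {E : Type*}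
    [NormedAddCommGroup E] [NormedSpace ℝ E] [FiniteDimensional ℝ E]
    (l : E →L[ℝ] ℝ) (v : E) (hv : l v = 1) (n : ℕ) (G : E → ℝ) (y₀ : E)
    (hG : ContDiffAt ℝ (n + 1) G y₀) (hG0 : ∀ᶠ y in 𝓝 y₀, l y = 0 → G y = 0) :
    ∃ g : E → ℝ, ContDiff ℝ n g ∧ ∀ᶠ y in 𝓝 y₀, G y = g y * l y := by
  have hne : ((n : WithTop ℕ∞) + 1) ≠ ∞ := by exact_mod_cast ENat.natCast_ne_top (n + 1)
  obtain ⟨r, hr, hball⟩ := Metric.eventually_nhds_iff_ball.1 ((hG.eventually hne).and hG0)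
  let χ : ContDiffBump y₀ := ⟨r / 3, r / 2, by positivity, by linarith⟩
  have hsupp : tsupport χ ⊆ Metric.ball y₀ r := by
    rw [χ.tsupport_eq]
    exact Metric.closedBall_subset_ball (by change r / 2 < r; linarith)
  have hχG : ContDiff ℝ (n + 1) (fun y => χ y * G y) := by
    refine contMDiff_iff_contDiff.1 <| contMDiff_of_tsupport fun y hy =>
      contMDiffAt_iff_contDiffAt.2 ?_
    have hy' : y ∈ tsupport χ := tsupport_mul_subset_left hy
    exact ((χ.contDiff (n := (n + 1 : ℕ))).contDiffAt).mul (hball y (hsupp hy')).1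
  obtain ⟨g, hg, hgl⟩ := hχG.exists_eq_mul_of_eq_zero_on_ker l v hv n _ (by
    intro y hy
    by_cases hyb : y ∈ Metric.ball y₀ r
    · simp [(hball y hyb).2 hy]
    · simp [image_eq_zero_of_notMem_tsupport fun h => hyb (hsupp h)])
  refine ⟨g, hg, ?_⟩
  filter_upwards [χ.eventuallyEq_one] with y hy
  rw [← hgl y, hy, Pi.one_apply, one_mul]

/-- A function which is regular at a point is a linear form in suitable local coordinates. -/
theorem ContDiffAt.exists_openPartialHomeomorph_linear {E : Type*}
    [NormedAddCommGroup E] [NormedSpace ℝ E] [CompleteSpace E] {n : WithTop ℕ∞}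
    {L : E → ℝ} {x₀ : E} (hL : ContDiffAt ℝ n L x₀) (hn : n ≠ 0) (hreg : fderiv ℝ L x₀ ≠ 0) :
    ∃ (e : OpenPartialHomeomorph E E) (l : E →L[ℝ] ℝ) (v : E),
      x₀ ∈ e.source ∧ ContDiffAt ℝ n e x₀ ∧ ContDiffAt ℝ n e.symm (e x₀) ∧ l v = 1 ∧
      ∀ x, l (e x) = L x := by
  set l := fderiv ℝ L x₀ with hl
  obtain ⟨w, hw⟩ : ∃ w, l w ≠ 0 := by
    by_contra! h
    exact hreg (ContinuousLinearMap.ext h)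
  set v := (l w)⁻¹ • w with hv
  have hlv : l v = 1 := by simp [hv, hw]
  let φ : E → E := fun x => x + (L x - l x) • v
  have hφ : ContDiffAt ℝ n φ x₀ :=
    contDiffAt_id.add ((hL.sub l.contDiff.contDiffAt).smul contDiffAt_const)
  have hφ' : HasFDerivAt φ (ContinuousLinearEquiv.refl ℝ E : E →L[ℝ] E) x₀ := by
    have h := (hasFDerivAt_id (𝕜 := ℝ) x₀).add
      (((hL.differentiableAt hn).hasFDerivAt.sub l.hasFDerivAt).smul_const v)
    convert! h using 1
    ext x
    simp [← hl]
  refine ⟨hφ.toOpenPartialHomeomorph φ hφ' hn, l, v,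
    hφ.mem_toOpenPartialHomeomorph_source hφ' hn, hφ, hφ.to_localInverse hφ' hn, hlv, fun x => ?_⟩
  simp [φ, hlv]

theorem eventually_eq_zero_imp_mem_closure {E : Type*}
    [NormedAddCommGroup E] [NormedSpace ℝ E] {L : E → ℝ} {U A : Set E} {x₀ : E}
    (e : OpenPartialHomeomorph E E) (l : E →L[ℝ] ℝ) (v : E) (hx₀ : x₀ ∈ e.source)
    (hv : l v = 1) (hle : ∀ x, l (e x) = L x) (hU : IsOpen U) (hA : IsOpen A)
    (hx₀U : x₀ ∈ U) (hx₀A : x₀ ∈ closure A) (hpos : ∀ x ∈ A, 0 < L x)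
    (hzero : ∀ x ∈ closure A ∩ U, x ∉ A → L x = 0) :
    ∀ᶠ x in 𝓝 x₀, L x = 0 → x ∈ closure A := by
  have hV : e.target ∩ e.symm ⁻¹' U ∈ 𝓝 (e x₀) := by
    refine inter_mem (e.open_target.mem_nhds (e.map_source hx₀)) ?_
    refine (e.continuousAt_symm (e.map_source hx₀)).preimage_mem_nhds ?_
    rw [e.left_inv hx₀]
    exact hU.mem_nhds hx₀U
  obtain ⟨r, hr, hball⟩ := Metric.mem_nhds_iff.1 hV
  have hnear : ∀ᶠ x in 𝓝 x₀, x ∈ e.source ∧ e x ∈ Metric.ball (e x₀) r :=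
    (e.open_source.eventually_mem hx₀).and
      ((e.continuousAt hx₀).eventually (Metric.ball_mem_nhds _ hr))
  set H : Set E := Metric.ball (e x₀) r ∩ {y | 0 < l y}
  have hHconn : IsPreconnected (e.symm '' H) := by
    refine IsPreconnected.image (Convex.isPreconnected ?_) _
      (e.continuousOn_symm.mono fun y hy => (hball hy.1).1)
    exact (convex_ball _ _).inter (convex_halfSpace_gt l.isLinear 0)
  have hHA : e.symm '' H ⊆ A := by
    refine hHconn.subset_of_closure_inter_subset hA ?_ ?_
    · obtain ⟨x, ⟨hxs, hxb⟩, hxA⟩ := mem_closure_iff_nhds.1 hx₀A _ hnear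
      exact ⟨x, ⟨e x, ⟨hxb, by simpa [hle] using hpos x hxA⟩, e.left_inv hxs⟩, hxA⟩
    · rintro x ⟨hxA, y, hy, rfl⟩
      by_contra hcon
      have h0 := hzero _ ⟨hxA, (hball hy.1).2⟩ hcon
      rw [← hle, e.right_inv (hball hy.1).1] at h0
      exact hy.2.ne' h0
  filter_upwards [hnear] with x ⟨hxs, hxb⟩ hx
  have hγ : Tendsto (fun t : ℝ => e x + t • v) (𝓝[>] 0) (𝓝 (e x)) := by
    have : Continuous (fun t : ℝ => e x + t • v) := by fun_prop
    simpa using (this.tendsto 0).mono_left nhdsWithin_le_nhds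
  have hlim : Tendsto (fun t : ℝ => e.symm (e x + t • v)) (𝓝[>] 0) (𝓝 x) := by
    have h := (e.continuousAt_symm (e.map_source hxs)).tendsto.comp hγ
    rwa [e.left_inv hxs] at h
  refine mem_closure_of_tendsto hlim ?_
  filter_upwards [hγ (Metric.isOpen_ball.mem_nhds hxb), self_mem_nhdsWithin] with t ht htpos
  refine hHA ⟨_, ⟨ht, ?_⟩, rfl⟩
  simpa [hle, hx, hv] using htpos

/-- Local divisibility by a regular defining function, to every finite order. -/
theorem ContDiffAt.exists_eventually_eq_mul {E : Type*}
    [NormedAddCommGroup E] [NormedSpace ℝ E] [FiniteDimensional ℝ E]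
    {L₁ L₂ : E → ℝ} {U A : Set E} {x₀ : E}
    (hL₁ : ContDiffAt ℝ ∞ L₁ x₀) (hL₂ : ContDiffAt ℝ ∞ L₂ x₀) (hreg : fderiv ℝ L₁ x₀ ≠ 0)
    (hU : IsOpen U) (hA : IsOpen A) (hx₀U : x₀ ∈ U) (hx₀A : x₀ ∈ closure A)
    (hpos : ∀ x ∈ A, 0 < L₁ x)
    (hzero₁ : ∀ x ∈ closure A ∩ U, x ∉ A → L₁ x = 0)
    (hzero₂ : ∀ x ∈ closure A ∩ U, x ∉ A → L₂ x = 0) (n : ℕ) :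
    ∃ g : E → ℝ, ContDiffAt ℝ n g x₀ ∧ ∀ᶠ x in 𝓝 x₀, L₂ x = g x * L₁ x := by
  have : CompleteSpace E := FiniteDimensional.complete ℝ E
  obtain ⟨e, l, v, hx₀, he, hesymm, hv, hle⟩ :=
    hL₁.exists_openPartialHomeomorph_linear (by simp) hreg
  have hcl := eventually_eq_zero_imp_mem_closure e l v hx₀ hv hle hU hA hx₀U hx₀A hpos hzero₁
  have hL₂0 : ∀ᶠ x in 𝓝 x₀, L₁ x = 0 → L₂ x = 0 := by
    filter_upwards [hcl, hU.mem_nhds hx₀U] with x hx hxU h0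
    exact hzero₂ x ⟨hx h0, hxU⟩ fun hxA => (hpos x hxA).ne' h0
  have hsymm_tendsto : Tendsto e.symm (𝓝 (e x₀)) (𝓝 x₀) := by
    simpa [e.left_inv hx₀] using (e.continuousAt_symm (e.map_source hx₀)).tendsto
  have hle_inf : ((n : WithTop ℕ∞) + 1) ≤ ∞ := by exact_mod_cast le_top
  have hG : ContDiffAt ℝ (n + 1) (L₂ ∘ e.symm) (e x₀) := by
    refine ContDiffAt.comp _ ?_ (hesymm.of_le hle_inf)
    rw [e.left_inv hx₀]
    exact hL₂.of_le hle_inf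
  obtain ⟨g, hg, hgl⟩ := hG.exists_eq_mul_of_eq_zero_on_ker l v hv n _ _ (by
    filter_upwards [hsymm_tendsto.eventually hL₂0, e.open_target.mem_nhds (e.map_source hx₀)]
      with y hy hyt hly
    refine hy ?_
    rw [← hle, e.right_inv hyt, hly])
  refine ⟨g ∘ e, hg.contDiffAt.comp _ (he.of_le (by exact_mod_cast le_top)), ?_⟩
  filter_upwards [(e.continuousAt hx₀).eventually hgl, e.open_source.mem_nhds hx₀] with x hx hxs
  simpa [e.left_inv hxs, hle] using hx

/-- Lemma on smooth quotients and square roots near a common regular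
zero level boundary. -/
theorem stmt_13 {N : Type*} [NormedAddCommGroup N] [NormedSpace ℝ N]
    [FiniteDimensional ℝ N]
    (U : Set N) (hU : IsOpen U)
    (L1 L2 : N → ℝ) (hL1 : ContDiffOn ℝ (⊤ : ℕ∞) L1 U) (hL2 : ContDiffOn ℝ (⊤ : ℕ∞) L2 U)
    (A : Set N) (hAU : A ⊆ U) (hAop : IsOpen A) (hAconn : IsConnected A)
    (hpos1 : ∀ x ∈ A, 0 < L1 x) (hpos2 : ∀ x ∈ A, 0 < L2 x)
    (C : Set N) (hC : C = (closure A ∩ U) \ A)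
    (hzero1 : ∀ x ∈ C, L1 x = 0) (hzero2 : ∀ x ∈ C, L2 x = 0)
    (hreg1 : ∀ x ∈ C, fderiv ℝ L1 x ≠ 0) (hreg2 : ∀ x ∈ C, fderiv ℝ L2 x ≠ 0) :
    (∃ μ : N → ℝ,
      (∀ x ∈ A, μ x = L2 x / L1 x) ∧
      (∀ x ∈ A ∪ C, 0 < μ x) ∧
      ContDiffOn ℝ (⊤ : ℕ∞) μ (A ∪ C)) ∧
    ContDiffOn ℝ (⊤ : ℕ∞) (fun x => Real.sqrt (L1 x * L2 x)) (A ∪ C) := by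
  classical
  have hCmem : ∀ x, x ∈ C ↔ (x ∈ closure A ∧ x ∈ U) ∧ x ∉ A := fun x => by rw [hC]; rfl
  have hACU : A ∪ C ⊆ U := union_subset hAU fun x hx => ((hCmem x).1 hx).1.2
  have hat1 : ∀ x ∈ U, ContDiffAt ℝ ∞ L1 x := fun x hx => hL1.contDiffAt (hU.mem_nhds hx)
  have hat2 : ∀ x ∈ U, ContDiffAt ℝ ∞ L2 x := fun x hx => hL2.contDiffAt (hU.mem_nhds hx)
  set μ : N → ℝ := fun x =>
    if x ∈ A then L2 x / L1 x else ‖fderiv ℝ L2 x‖ / ‖fderiv ℝ L1 x‖ with hμ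
  have hμA : ∀ x ∈ A, μ x = L2 x / L1 x := fun x hx => if_pos hx
  have hμpos : ∀ x ∈ A ∪ C, 0 < μ x := by
    rintro x (hx | hx)
    · rw [hμA x hx]
      exact div_pos (hpos2 x hx) (hpos1 x hx)
    · simp only [hμ, if_neg ((hCmem x).1 hx).2]
      exact div_pos (norm_pos_iff.2 (hreg2 x hx)) (norm_pos_iff.2 (hreg1 x hx))
  -- at a boundary point, any differentiable local quotient takes the value `μ`
  have hμC : ∀ x ∈ C, ∀ g : N → ℝ, DifferentiableAt ℝ g x →
      (∀ᶠ y in 𝓝 x, L2 y = g y * L1 y) → μ x = g x := by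
    intro x hx g hg hfac
    obtain ⟨⟨hxcl, hxU⟩, hxA⟩ := (hCmem x).1 hx
    have hD1 := ((hat1 x hxU).differentiableAt (by simp)).hasFDerivAt
    have hD2 : fderiv ℝ L2 x = g x • fderiv ℝ L1 x := by
      have h := (hg.hasFDerivAt.mul hD1).congr_of_eventuallyEq hfac
      simpa [hzero1 x hx] using h.fderiv
    have hg0 : 0 ≤ g x := by
      have : (𝓝[A] x).NeBot := mem_closure_iff_nhdsWithin_neBot.1 hxcl
      refine ge_of_tendsto (hg.continuousAt.tendsto.mono_left (nhdsWithin_le_nhds (s := A))) ?_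
      filter_upwards [nhdsWithin_le_nhds hfac, self_mem_nhdsWithin] with y hy hyA
      have h2 := hpos2 y hyA
      rw [hy] at h2
      exact (pos_of_mul_pos_left h2 (hpos1 y hyA).le).le
    simp only [hμ, if_neg hxA, hD2, norm_smul, Real.norm_eq_abs, abs_of_nonneg hg0]
    exact mul_div_cancel_right₀ _ (norm_ne_zero_iff.2 (hreg1 x hx))
  have hμsmooth : ContDiffOn ℝ ∞ μ (A ∪ C) := by
    rintro x (hx | hx)
    · refine (((hat2 x (hAU hx)).div (hat1 x (hAU hx)) (hpos1 x hx).ne').congr_of_eventuallyEq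
        ?_).contDiffWithinAt
      filter_upwards [hAop.mem_nhds hx] with y hy using hμA y hy
    · obtain ⟨⟨hxcl, hxU⟩, hxA⟩ := (hCmem x).1 hx
      refine contDiffWithinAt_infty.2 fun n => ?_
      obtain ⟨g, hg, hfac⟩ := (hat1 x hxU).exists_eventually_eq_mul (hat2 x hxU) (hreg1 x hx)
        hU hAop hxU hxcl hpos1 (fun y hy hyA => hzero1 y ((hCmem y).2 ⟨hy, hyA⟩))
        (fun y hy hyA => hzero2 y ((hCmem y).2 ⟨hy, hyA⟩)) (n + 1)
      have hgev : ∀ᶠ y in 𝓝 x, ContDiffAt ℝ ((n + 1 : ℕ) : WithTop ℕ∞) g y :=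
        hg.eventually (by exact_mod_cast ENat.natCast_ne_top (n + 1))
      have heq : ∀ᶠ y in 𝓝 x, y ∈ A ∪ C → μ y = g y := by
        filter_upwards [hgev, hfac.eventually_nhds] with y hy hfy hyAC
        rcases hyAC with hyA | hyC
        · rw [hμA y hyA, hfy.self_of_nhds, mul_div_cancel_right₀ _ (hpos1 y hyA).ne']
        · exact hμC y hyC g (hy.differentiableAt (by simp)) hfy
      refine ((hg.of_le (by exact_mod_cast n.le_succ)).contDiffWithinAt).congr_of_eventuallyEq
        (eventually_nhdsWithin_iff.2 heq) (heq.self_of_nhds (Or.inr hx))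
  refine ⟨⟨μ, hμA, hμpos, hμsmooth⟩, ?_⟩
  refine ((hL1.mono hACU).mul (hμsmooth.sqrt fun x hx => (hμpos x hx).ne')).congr ?_
  rintro x (hx | hx)
  · have h1 := hpos1 x hx
    have h : L1 x * L2 x = L1 x ^ 2 * μ x := by
      rw [hμA x hx]
      field_simp
    rw [h, Real.sqrt_mul (sq_nonneg _), Real.sqrt_sq h1.le]
  · simp [hzero1 x hx]
end
end

section
/- Let A0 ⊆ V ∖ {0} be a nonempty open convex subset, and let C0 denote its topological boundary taken in V ∖ {0} (i.e., C0 = Ā0 ∖ A0 where Ā0 is the closure of A0 in V ∖ {0}). Assume C0 is conic and salient. Then: (i) A0 is conic and salient; and (ii) the topological boundary of A0 taken in V equals C0 ∪ {0}, and this set is path-connected. -/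
open Set Module

noncomputable section

variable {V : Type*} [NormedAddCommGroup V] [NormedSpace ℝ V]

/-- properties of the interior of a weak cone: if the boundary
`C₀ = Ā₀ ∖ A₀` (boundary in `V ∖ {0}`) of a nonempty open convex `A₀ ⊆ V ∖ {0}`
is conic and salient, then `A₀` is conic and salient, the topological boundary of
`A₀` in `V` is `C₀ ∪ {0}`, and this boundary is path-connected. -/
theorem stmt_14 [FiniteDimensional ℝ V] (hn : 2 ≤ finrank ℝ V)
    (A₀ : Set V) (hNe : A₀.Nonempty) (h0 : (0 : V) ∉ A₀)
    (hop : IsOpen A₀) (hconv : Convex ℝ A₀)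
    (C₀ : Set V) (hC₀ : C₀ = (closure A₀ \ {0}) \ A₀)
    (hCconic : Conic C₀) (hCsal : Salient C₀) :
    (Conic A₀ ∧ Salient A₀) ∧
    frontier A₀ = C₀ ∪ {0} ∧
    IsPathConnected (C₀ ∪ {0} : Set V) := by
  have hfr : frontier A₀ = closure A₀ \ A₀ := hop.frontier_eq
  have hA : Conic A₀ := by
    intro a ha c hc
    have hray : IsPreconnected ((fun t : ℝ => t • a) '' Ioi 0) :=
      isPreconnected_Ioi.image _ (by fun_prop)
    refine hray.subset_of_closure_inter_subset hop
      ⟨a, ⟨1, mem_Ioi.2 one_pos, one_smul ℝ a⟩, ha⟩ ?_ ⟨c, hc, rfl⟩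
    rintro _ ⟨hcl, t, ht, rfl⟩
    have ht' : (0 : ℝ) < t := ht
    by_contra hta
    have hmem : t • a ∈ C₀ := by
      rw [hC₀]
      exact ⟨⟨hcl, smul_ne_zero ht'.ne' fun h => h0 (h ▸ ha)⟩, hta⟩
    have hmem' := hCconic _ hmem t⁻¹ (inv_pos.2 ht')
    rw [inv_smul_smul₀ ht'.ne', hC₀] at hmem'
    exact hmem'.2 ha
  have hzero : (0 : V) ∈ closure A₀ := by
    obtain ⟨a, ha⟩ := hNe
    have hmaps : MapsTo (fun t : ℝ => t • a) (Ioi 0) A₀ := fun t ht => hA a ha t ht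
    have hcl := hmaps.closure (by fun_prop)
    rw [closure_Ioi] at hcl
    simpa using hcl (mem_Ici.2 le_rfl)
  refine ⟨⟨hA, fun v hv hv' => h0 ?_⟩, ?_, ?_⟩
  · simpa using hconv.midpoint_mem hv hv'
  · rw [hfr, hC₀]
    ext x
    by_cases hx : x = 0
    · simp [hx, hzero, h0]
    · simp [hx]
  · have hstar : StarConvex ℝ (0 : V) (C₀ ∪ {0}) := by
      rw [starConvex_zero_iff]
      intro x hx t ht _
      rcases hx with hx | rfl
      · rcases ht.eq_or_lt with rfl | ht
        · simp
        · exact Or.inl (hCconic x hx t ht)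
      · simp
    exact hstar.isPathConnected (Or.inr rfl)
end
end
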